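/- arXiv:2405.12088 — 2 statements merged into one kernel-verified Lean document; each statement's English description precedes it below -/
import Mathlib

section
/- There exist positive real constants c1 and c2 such that for every sufficiently large positive integer n, π(n) + π(⌊n/2⌋) + c1·n^{2/3}/(log n)^{4/3} ≤ F_{18,3}(n) ≤ π(n) + π(⌊n/2⌋) + c2·n^{5/6}. -/
open Finset Filter

/-- `Fkd k d n` is the maximum cardinality of a set `A ⊆ {1,…,n}` such that there are no
`a_1 < a_2 < ⋯ < a_k` in `A` and positive integer `x` with `a_1 ⋯ a_k = x ^ d`. -/
noncomputable def Fkd (k d n : ℕ) : ℕ :=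
  sSup {m : ℕ | ∃ A : Finset ℕ, A ⊆ Finset.Icc 1 n ∧ A.card = m ∧
    ∀ (a : Fin k → ℕ) (x : ℕ), (∀ i, a i ∈ A) → StrictMono a → 0 < x →
      (∏ i, a i) ≠ x ^ d}

def GoodS (A : Finset ℕ) : Prop :=
  ∀ S : Finset ℕ, S ⊆ A → S.card = 18 → ∀ x : ℕ, 0 < x → ∏ a ∈ S, a ≠ x ^ 3

lemma good_of_fin {A : Finset ℕ} (h : ∀ (a : Fin 18 → ℕ) (x : ℕ), (∀ i, a i ∈ A) →
    StrictMono a → 0 < x → (∏ i, a i) ≠ x ^ 3) : GoodS A := by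
  intro S hS hc x hx he
  refine h (S.orderEmbOfFin hc) x (fun i => hS (S.orderEmbOfFin_mem hc i))
    (S.orderEmbOfFin hc).strictMono hx ?_
  rw [← he]
  conv_rhs => rw [← S.map_orderEmbOfFin_univ hc]
  rw [Finset.prod_map]
  rfl

lemma fin_of_good {A : Finset ℕ} (h : GoodS A) : ∀ (a : Fin 18 → ℕ) (x : ℕ), (∀ i, a i ∈ A) →
    StrictMono a → 0 < x → (∏ i, a i) ≠ x ^ 3 := by
  intro a x ha hm hx he
  refine h (Finset.univ.image a) ?_ ?_ x hx ?_
  · intro y hy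
    obtain ⟨i, -, rfl⟩ := Finset.mem_image.1 hy
    exact ha i
  · rw [Finset.card_image_of_injective _ hm.injective]; simp
  · rw [Finset.prod_image (fun i _ j _ hij => hm.injective hij)]
    exact he

lemma Fkd_bdd (n : ℕ) : BddAbove {m : ℕ | ∃ A : Finset ℕ, A ⊆ Finset.Icc 1 n ∧ A.card = m ∧
    ∀ (a : Fin 18 → ℕ) (x : ℕ), (∀ i, a i ∈ A) → StrictMono a → 0 < x →
      (∏ i, a i) ≠ x ^ 3} := by
  refine ⟨n, ?_⟩
  rintro m ⟨A, hA, rfl, -⟩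
  simpa using Finset.card_le_card hA

lemma le_Fkd {n : ℕ} {A : Finset ℕ} (hA : A ⊆ Finset.Icc 1 n) (hg : GoodS A) :
    A.card ≤ Fkd 18 3 n :=
  le_csSup (Fkd_bdd n) ⟨A, hA, rfl, fin_of_good hg⟩

lemma exists_Fkd (n : ℕ) : ∃ A : Finset ℕ, A ⊆ Finset.Icc 1 n ∧ GoodS A ∧
    A.card = Fkd 18 3 n := by
  have hne : {m : ℕ | ∃ A : Finset ℕ, A ⊆ Finset.Icc 1 n ∧ A.card = m ∧
    ∀ (a : Fin 18 → ℕ) (x : ℕ), (∀ i, a i ∈ A) → StrictMono a → 0 < x →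
      (∏ i, a i) ≠ x ^ 3}.Nonempty := by
    refine ⟨0, ∅, by simp, rfl, ?_⟩
    intro a x ha
    exact absurd (ha 0) (by simp)
  obtain ⟨A, h1, h2, h3⟩ := Nat.sSup_mem hne (Fkd_bdd n)
  exact ⟨A, h1, good_of_fin h3, h2⟩

/-- Erdős-type factorization. -/
lemma exists_fac (a : ℕ) (ha : 1 ≤ a) : ∃ u v : ℕ, a = u * v ∧ v ≤ u ∧
    (u.Prime ∨ u ^ 3 ≤ a ^ 2) := by
  classical
  have hex : ∃ u : ℕ, u ∣ a ∧ a ≤ u * u := ⟨a, dvd_rfl, by nlinarith⟩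
  obtain ⟨⟨v, hv⟩, hu⟩ := Nat.find_spec hex
  have hmin : ∀ m, m ∣ a → a ≤ m * m → Nat.find hex ≤ m := fun m h1 h2 => Nat.find_min' hex ⟨h1, h2⟩
  generalize Nat.find hex = u at *
  have hu0 : 0 < u := by
    rcases Nat.eq_zero_or_pos u with h | h
    · subst h; omega
    · exact h
  have hvu : v ≤ u := by
    by_contra hc
    push Not at hc
    nlinarith
  refine ⟨u, v, hv, hvu, ?_⟩
  by_cases hp : u.Prime
  · exact Or.inl hp
  right
  have hv0 : 0 < v := by
    rcases Nat.eq_zero_or_pos v with h | h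
    · subst h; omega
    · exact h
  rcases Nat.lt_or_ge u 2 with h2 | h2
  · have : u = 1 := by omega
    subst this
    nlinarith
  obtain ⟨x, hxd, hx1, hx2⟩ := (Nat.not_prime_iff_exists_dvd_lt h2).1 hp
  obtain ⟨y, hy⟩ := hxd
  have key : ∀ x y : ℕ, u = x * y → x < u → x ≤ v := by
    intro x y hxy hlt
    have hxa : x * x < a := by
      by_contra hc
      push Not at hc
      have := hmin x ⟨y * v, by rw [hv, hxy]; ring⟩ hc
      omega
    have hx0 : 0 < x := by
      rcases Nat.eq_zero_or_pos x with h | h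
      · subst h; omega
      · exact h
    have hyv : a = x * (y * v) := by rw [hv, hxy]; ring
    have hge : a ≤ (y * v) * (y * v) := by
      have h3 : x < y * v := by
        rw [hyv] at hxa
        exact lt_of_mul_lt_mul_left hxa (by omega)
      calc a = x * (y * v) := hyv
        _ ≤ (y * v) * (y * v) := by gcongr
    have h4 := hmin (y * v) ⟨x, by rw [hyv]; ring⟩ hge
    rw [hxy] at h4
    have hy0 : 0 < y := by
      rcases Nat.eq_zero_or_pos y with h | h
      · subst h; omega
      · exact h
    rw [mul_comm x y] at h4
    exact le_of_mul_le_mul_left h4 hy0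
  have hx := key x y hy hx2
  have hylt : y < u := by
    rw [hy]
    have hy0 : 0 < y := by
      rcases Nat.eq_zero_or_pos y with h | h
      · subst h; omega
      · exact h
    nlinarith
  have hy' := key y x (by rw [hy]; ring) hylt
  have : u ≤ v * v := by
    calc u = x * y := hy
      _ ≤ v * v := by gcongr
  calc u ^ 3 = u ^ 2 * u := by ring
    _ ≤ u ^ 2 * (v * v) := by gcongr
    _ = a ^ 2 := by rw [hv]; ring

/-- no `K_{6,3}` -/
lemma noK63 {A : Finset ℕ} (hpos : ∀ a ∈ A, 1 ≤ a) (hg : GoodS A) (u v : ℕ → ℕ)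
    (huv : ∀ a ∈ A, a = u a * v a)
    (W t : Finset ℕ) (ht : t.card = 3)
    (h : ∀ w ∈ W, t ⊆ (A.filter (fun a => u a = w)).image v) : W.card ≤ 5 := by
  classical
  by_contra hc
  push Not at hc
  obtain ⟨W', hW', hW6⟩ := Finset.exists_subset_card_eq (show 6 ≤ W.card by omega)
  have hmem : ∀ w ∈ W', ∀ x ∈ t, w * x ∈ A ∧ u (w * x) = w ∧ v (w * x) = x := by
    intro w hw x hx
    obtain ⟨a, ha, hax⟩ := Finset.mem_image.1 (h w (hW' hw) hx)
    obtain ⟨haA, hau⟩ := Finset.mem_filter.1 ha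
    have := huv a haA
    rw [hau, hax] at this
    rw [← this]
    exact ⟨haA, hau, hax⟩
  have hinj : Set.InjOn (fun z : ℕ × ℕ => z.1 * z.2) (W' ×ˢ t : Finset (ℕ × ℕ)) := by
    rintro ⟨w, x⟩ h1 ⟨w', x'⟩ h2 he
    simp only [Finset.coe_product, Set.mem_prod, Finset.mem_coe] at h1 h2 he
    obtain ⟨-, a1, a2⟩ := hmem w h1.1 x h1.2
    obtain ⟨-, b1, b2⟩ := hmem w' h2.1 x' h2.2
    rw [he] at a1 a2
    exact Prod.ext (a1.symm.trans b1) (a2.symm.trans b2)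
  have hW0 : ∀ w ∈ W', ∀ x ∈ t, 0 < w * x := fun w hw x hx => hpos _ (hmem w hw x hx).1
  obtain ⟨x0, hx0⟩ := Finset.card_pos.1 (show 0 < t.card by omega)
  obtain ⟨w0, hw0⟩ := Finset.card_pos.1 (show 0 < W'.card by omega)
  refine hg ((W' ×ˢ t).image (fun z : ℕ × ℕ => z.1 * z.2)) ?_ ?_
    ((∏ w ∈ W', w) * (∏ x ∈ t, x) ^ 2) ?_ ?_
  · intro y hy
    obtain ⟨⟨w, x⟩, hz, rfl⟩ := Finset.mem_image.1 hy
    rw [Finset.mem_product] at hz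
    exact (hmem w hz.1 x hz.2).1
  · rw [Finset.card_image_of_injOn hinj, Finset.card_product, hW6, ht]
  · apply Nat.mul_pos
    · exact Finset.prod_pos fun w hw => Nat.pos_of_mul_pos_right (hW0 w hw x0 hx0)
    · exact pow_pos (Finset.prod_pos fun x hx => Nat.pos_of_mul_pos_left (hW0 w0 hw0 x hx)) 2
  · rw [Finset.prod_image hinj, Finset.prod_product]
    have e1 : ∀ w ∈ W', (∏ x ∈ t, w * x) = w ^ 3 * ∏ x ∈ t, x := by
      intro w _
      rw [Finset.prod_mul_distrib, Finset.prod_const, ht]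
    rw [Finset.prod_congr rfl e1, Finset.prod_mul_distrib, Finset.prod_const, hW6,
      Finset.prod_pow]
    ring

lemma excess_bound (d : ℕ) (s : ℝ) (hs : 0 < s) :
    ((d - 2 : ℕ) : ℝ) ≤ s + (d.choose 3 : ℝ) * (6 / s ^ 2) := by
  have h1 : (d - 2) ^ 3 ≤ 6 * d.choose 3 := by
    have := Nat.pow_sub_le_descFactorial d 3
    rw [Nat.descFactorial_eq_factorial_mul_choose] at this
    simpa [Nat.factorial] using this
  have h2 : (((d - 2 : ℕ) : ℝ)) ^ 3 ≤ 6 * (d.choose 3 : ℝ) := by exact_mod_cast h1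
  set y : ℝ := ((d - 2 : ℕ) : ℝ)
  have hy : 0 ≤ y := Nat.cast_nonneg _
  have h3 : (d.choose 3 : ℝ) * (6 / s ^ 2) = 6 * (d.choose 3 : ℝ) / s ^ 2 := by ring
  rw [h3]
  rcases le_total y s with h | h
  · have : 0 ≤ 6 * (d.choose 3 : ℝ) / s ^ 2 := by positivity
    linarith
  · have : y ≤ 6 * (d.choose 3 : ℝ) / s ^ 2 := by
      rw [le_div_iff₀ (by positivity)]
      have : s ^ 2 ≤ y ^ 2 := by gcongr
      nlinarith
    linarith

lemma card_triples (M m : ℕ) :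
    (((Finset.Icc 1 M).powersetCard 3).filter (fun t => t.sup id = m)).card ≤ m ^ 2 := by
  classical
  have : (((Finset.Icc 1 M).powersetCard 3).filter (fun t => t.sup id = m)).card
      ≤ ((Finset.Icc 1 m).powersetCard 2).card := by
    have hm : ∀ t ∈ ((Finset.Icc 1 M).powersetCard 3).filter (fun t => t.sup id = m), m ∈ t := by
      intro t ht
      obtain ⟨h1, h2⟩ := Finset.mem_filter.1 ht
      obtain ⟨h3, h4⟩ := Finset.mem_powersetCard.1 h1
      obtain ⟨i, hi, he⟩ := Finset.exists_mem_eq_sup t (Finset.card_pos.1 (by omega)) id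
      rw [← h2, he]; exact hi
    apply Finset.card_le_card_of_injOn (fun t => t.erase m)
    · intro t ht
      have hmt := hm t ht
      obtain ⟨h1, h2⟩ := Finset.mem_filter.1 ht
      obtain ⟨h3, h4⟩ := Finset.mem_powersetCard.1 h1
      refine Finset.mem_coe.2 (Finset.mem_powersetCard.2 ⟨?_, ?_⟩)
      · intro x hx
        have hx' := Finset.mem_of_mem_erase hx
        have h5 : x ≤ t.sup id := Finset.le_sup (f := id) hx'
        have := Finset.mem_Icc.1 (h3 hx')
        exact Finset.mem_Icc.2 ⟨this.1, by omega⟩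
      · rw [Finset.card_erase_of_mem hmt, h4]
    · intro t ht t' ht' he
      simp only at he
      rw [← Finset.insert_erase (hm t ht), he, Finset.insert_erase (hm t' ht')]
  refine this.trans ?_
  rw [Finset.card_powersetCard, Nat.card_Icc]
  simpa using Nat.choose_le_pow m 2

/-- combinatorial form of the upper bound, with general weights -/
lemma upper_comb {n M : ℕ} (hM : ∀ x, x * x ≤ n → x ≤ M) {A : Finset ℕ}
    (hA : A ⊆ Finset.Icc 1 n) (hg : GoodS A) (s g : ℕ → ℝ)
    (hs : ∀ w, 1 ≤ w → 0 < s w) (hg0 : ∀ z, 0 ≤ g z)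
    (hsg : ∀ w z, 1 ≤ w → 1 ≤ z → z * z ≤ n → w * z ≤ n → 6 / s w ^ 2 ≤ g z) :
    (A.card : ℝ) ≤ Nat.primeCounting n + Nat.primeCounting (n / 2)
      + 2 * ((Finset.Icc 1 n).filter (fun w => w ^ 3 ≤ n ^ 2)).card
      + ∑ w ∈ Finset.Icc 1 n, s w + 5 * ∑ z ∈ Finset.Icc 1 M, (z : ℝ) ^ 2 * g z := by
  classical
  have hpos : ∀ a ∈ A, 1 ≤ a := fun a ha => (Finset.mem_Icc.1 (hA ha)).1
  have hex : ∀ a : ℕ, ∃ p : ℕ × ℕ, 1 ≤ a → (a = p.1 * p.2 ∧ p.2 ≤ p.1 ∧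
      (p.1.Prime ∨ p.1 ^ 3 ≤ a ^ 2)) := by
    intro a
    by_cases h : 1 ≤ a
    · obtain ⟨u, v, h⟩ := exists_fac a h
      exact ⟨(u, v), fun _ => h⟩
    · exact ⟨(0, 0), fun h' => absurd h' h⟩
  choose p hp using hex
  set u : ℕ → ℕ := fun a => (p a).1 with hu
  set v : ℕ → ℕ := fun a => (p a).2 with hv
  have huv : ∀ a ∈ A, a = u a * v a := fun a ha => (hp a (hpos a ha)).1
  have hvu : ∀ a ∈ A, v a ≤ u a := fun a ha => (hp a (hpos a ha)).2.1
  have hpr : ∀ a ∈ A, (u a).Prime ∨ (u a) ^ 3 ≤ a ^ 2 := fun a ha => (hp a (hpos a ha)).2.2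
  have hle : ∀ a ∈ A, a ≤ n := fun a ha => (Finset.mem_Icc.1 (hA ha)).2
  have hu1 : ∀ a ∈ A, 1 ≤ u a := by
    intro a ha
    have h1 := hpos a ha
    rw [huv a ha] at h1
    exact Nat.pos_of_mul_pos_right h1
  have hv1 : ∀ a ∈ A, 1 ≤ v a := by
    intro a ha
    have h1 := hpos a ha
    rw [huv a ha] at h1
    exact Nat.pos_of_mul_pos_left h1
  have hun : ∀ a ∈ A, u a ≤ n := by
    intro a ha
    have h1 := hle a ha
    rw [huv a ha] at h1
    exact (Nat.le_mul_of_pos_right _ (hv1 a ha)).trans h1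
  clear_value u v
  set N : ℕ → Finset ℕ := fun w => (A.filter (fun a => u a = w)).image v with hN
  have hNmem : ∀ w x, x ∈ N w → ∃ a ∈ A, u a = w ∧ v a = x ∧ a = w * x := by
    intro w x hx
    obtain ⟨a, ha, hax⟩ := Finset.mem_image.1 hx
    obtain ⟨haA, hau⟩ := Finset.mem_filter.1 ha
    refine ⟨a, haA, hau, hax, ?_⟩
    rw [← hau, ← hax]; exact huv a haA
  have hNcard : ∀ w, (N w).card = (A.filter (fun a => u a = w)).card := by
    intro w
    apply Finset.card_image_of_injOn
    intro a ha b hb hab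
    obtain ⟨ha1, ha2⟩ := Finset.mem_filter.1 ha
    obtain ⟨hb1, hb2⟩ := Finset.mem_filter.1 hb
    rw [huv a ha1, huv b hb1, ha2, hb2, hab]
  have hNz : ∀ w, ∀ x ∈ N w, 1 ≤ w ∧ 1 ≤ x ∧ x * x ≤ n ∧ w * x ≤ n := by
    intro w x hx
    obtain ⟨a, ha, h1, h2, h3⟩ := hNmem w x hx
    have e1 := hu1 a ha
    have e2 := hv1 a ha
    have e3 := hvu a ha
    have e4 := hle a ha
    rw [h1] at e1 e3; rw [h2] at e2 e3
    rw [h3] at e4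
    refine ⟨e1, e2, ?_, e4⟩
    exact (Nat.mul_le_mul_right x e3).trans e4
  have hNM : ∀ w, N w ⊆ Finset.Icc 1 M := by
    intro w x hx
    obtain ⟨_, h1, h2, _⟩ := hNz w x hx
    exact Finset.mem_Icc.2 ⟨h1, hM x h2⟩
  have hcard : A.card = ∑ w ∈ Finset.Icc 1 n, (N w).card := by
    rw [Finset.card_eq_sum_card_fiberwise (f := u) (t := Finset.Icc 1 n)]
    · exact Finset.sum_congr rfl fun w _ => (hNcard w).symm
    · intro a ha
      exact Finset.mem_coe.2 (Finset.mem_Icc.2 ⟨hu1 a ha, hun a ha⟩)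
  -- base bound
  have hbase : ∀ w ∈ Finset.Icc 1 n, (N w).card ≤ ((if w.Prime then 1 else 0) +
      (if w.Prime ∧ w ≤ n / 2 then 1 else 0) + 2 * (if w ^ 3 ≤ n ^ 2 then 1 else 0))
        + ((N w).card - 2) := by
    intro w hw
    rcases Finset.eq_empty_or_nonempty (N w) with h | ⟨x, hx⟩
    · rw [h]; simp
    obtain ⟨a, ha, h1, h2, h3⟩ := hNmem w x hx
    by_cases hw3 : w ^ 3 ≤ n ^ 2
    · simp only [hw3, if_true]; omega
    have hwp : w.Prime := by
      rcases hpr a ha with h | h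
      · rwa [h1] at h
      · exfalso
        apply hw3
        rw [h1] at h
        exact h.trans (Nat.pow_le_pow_left (hle a ha) 2)
    by_cases hw2 : w ≤ n / 2
    · simp only [hwp, hw2, and_self, if_true]; omega
    have : (N w).card ≤ 1 := by
      have : N w ⊆ {1} := by
        intro y hy
        obtain ⟨_, h1, _, h2⟩ := hNz w y hy
        rw [Finset.mem_singleton]
        by_contra hne
        have : 2 ≤ y := by omega
        have : w * 2 ≤ w * y := Nat.mul_le_mul_left w this
        omega
      exact Finset.card_le_card this
    simp only [hwp, if_true]; omega
  have hsum : A.card ≤ Nat.primeCounting n + Nat.primeCounting (n / 2)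
      + 2 * ((Finset.Icc 1 n).filter (fun w => w ^ 3 ≤ n ^ 2)).card
      + ∑ w ∈ Finset.Icc 1 n, ((N w).card - 2) := by
    rw [hcard]
    refine (Finset.sum_le_sum hbase).trans ?_
    rw [Finset.sum_add_distrib, Finset.sum_add_distrib, Finset.sum_add_distrib, ← Finset.mul_sum,
      ← Finset.card_filter, ← Finset.card_filter, ← Finset.card_filter]
    gcongr
    · rw [← Nat.primesLE_card_eq_primeCounting]
      apply Finset.card_le_card
      intro w hw
      simp only [Finset.mem_filter, Finset.mem_Icc, Nat.mem_primesLE] at hw ⊢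
      tauto
    · rw [← Nat.primesLE_card_eq_primeCounting]
      apply Finset.card_le_card
      intro w hw
      simp only [Finset.mem_filter, Finset.mem_Icc, Nat.mem_primesLE] at hw ⊢
      tauto
  have hsumR : (A.card : ℝ) ≤ Nat.primeCounting n + Nat.primeCounting (n / 2)
      + 2 * ((Finset.Icc 1 n).filter (fun w => w ^ 3 ≤ n ^ 2)).card
      + ∑ w ∈ Finset.Icc 1 n, (((N w).card - 2 : ℕ) : ℝ) := by exact_mod_cast hsum
  have hexc : ∑ w ∈ Finset.Icc 1 n, (((N w).card - 2 : ℕ) : ℝ) ≤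
      ∑ w ∈ Finset.Icc 1 n, s w +
      ∑ w ∈ Finset.Icc 1 n, ((N w).card.choose 3 : ℝ) * (6 / s w ^ 2) := by
    rw [← Finset.sum_add_distrib]
    exact Finset.sum_le_sum fun w hw => excess_bound _ _ (hs w (Finset.mem_Icc.1 hw).1)
  have htri : ∑ w ∈ Finset.Icc 1 n, ((N w).card.choose 3 : ℝ) * (6 / s w ^ 2) ≤
      5 * ∑ z ∈ Finset.Icc 1 M, (z : ℝ) ^ 2 * g z := by
    set T := (Finset.Icc 1 M).powersetCard 3 with hT
    calc ∑ w ∈ Finset.Icc 1 n, ((N w).card.choose 3 : ℝ) * (6 / s w ^ 2)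
        ≤ ∑ w ∈ Finset.Icc 1 n, ∑ t ∈ T.filter (fun t => t ⊆ N w), g (t.sup id) := by
          apply Finset.sum_le_sum
          intro w hw
          have heq : T.filter (fun t => t ⊆ N w) = (N w).powersetCard 3 := by
            ext t
            simp only [hT, Finset.mem_filter, Finset.mem_powersetCard]
            constructor
            · rintro ⟨⟨_, h1⟩, h2⟩; exact ⟨h2, h1⟩
            · rintro ⟨h2, h1⟩; exact ⟨⟨h2.trans (hNM w), h1⟩, h2⟩
          rw [heq, ← Finset.card_powersetCard, ← nsmul_eq_mul]
          apply Finset.card_nsmul_le_sum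
          intro t ht
          obtain ⟨h1, h2⟩ := Finset.mem_powersetCard.1 ht
          obtain ⟨i, hi, he⟩ := Finset.exists_mem_eq_sup t (Finset.card_pos.1 (by omega)) id
          rw [he]
          obtain ⟨q1, q2, q3, q4⟩ := hNz w i (h1 hi)
          exact hsg w i q1 q2 q3 q4
      _ = ∑ t ∈ T, ∑ w ∈ (Finset.Icc 1 n).filter (fun w => t ⊆ N w), g (t.sup id) := by
          apply Finset.sum_comm'
          intro w t
          simp only [Finset.mem_filter]
          tauto
      _ ≤ ∑ t ∈ T, 5 * g (t.sup id) := by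
          apply Finset.sum_le_sum
          intro t ht
          rw [Finset.sum_const, nsmul_eq_mul]
          gcongr
          · exact hg0 _
          · have := noK63 hpos hg u v huv ((Finset.Icc 1 n).filter (fun w => t ⊆ N w)) t
              (Finset.mem_powersetCard.1 ht).2 (fun w hw => (Finset.mem_filter.1 hw).2)
            exact_mod_cast this
      _ = 5 * ∑ t ∈ T, g (t.sup id) := by rw [Finset.mul_sum]
      _ = 5 * ∑ z ∈ Finset.Icc 1 M, ∑ t ∈ T.filter (fun t => t.sup id = z), g (t.sup id) := by
          congr 1
          symm
          apply Finset.sum_fiberwise_of_maps_to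
          intro t ht
          obtain ⟨h1, h2⟩ := Finset.mem_powersetCard.1 ht
          obtain ⟨i, hi, he⟩ := Finset.exists_mem_eq_sup t (Finset.card_pos.1 (by omega)) id
          rw [he]; exact h1 hi
      _ ≤ 5 * ∑ z ∈ Finset.Icc 1 M, (z : ℝ) ^ 2 * g z := by
          gcongr with z hz
          rw [Finset.sum_congr rfl (g := fun _ => g z)
            (fun t ht => by rw [(Finset.mem_filter.1 ht).2]), Finset.sum_const, nsmul_eq_mul]
          gcongr
          · exact hg0 _
          · exact_mod_cast card_triples M z
  linarith

lemma upper_bound (n : ℕ) (hn : 1 ≤ n) : (Fkd 18 3 n : ℝ) ≤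
    (Nat.primeCounting n : ℝ) + (Nat.primeCounting (n / 2) : ℝ)
            + 100 * (n : ℝ) ^ ((5 : ℝ)/6) := by
  obtain ⟨A, hA, hg, hc⟩ := exists_Fkd n
  rw [← hc]
  obtain ⟨r, hr⟩ : ∃ r : ℝ, r = (n : ℝ) ^ ((1 : ℝ)/6) := ⟨_, rfl⟩
  have hn1 : (1 : ℝ) ≤ n := by exact_mod_cast hn
  have hn0 : (0 : ℝ) ≤ n := by linarith
  have hr1 : 1 ≤ r := by rw [hr]; exact Real.one_le_rpow hn1 (by norm_num)
  have hr0 : 0 < r := by linarith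
  have hr6 : r ^ 6 = n := by
    rw [hr, ← Real.rpow_natCast, ← Real.rpow_mul hn0]; norm_num
  have hr5 : (n : ℝ) ^ ((5 : ℝ)/6) = r ^ 5 := by
    rw [hr, ← Real.rpow_natCast, ← Real.rpow_mul hn0]; norm_num
  rw [hr5]
  obtain ⟨c, hcdef⟩ : ∃ c : ℕ → ℝ, c = fun k : ℕ => (k : ℝ) ^ ((1 : ℝ)/3) := ⟨_, rfl⟩
  have hc3 : ∀ k, c k ^ 3 = k := by
    intro k
    rw [hcdef]
    simp only
    rw [← Real.rpow_natCast, ← Real.rpow_mul (Nat.cast_nonneg k)]; norm_num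
  have hc0 : ∀ k, 0 ≤ c k := by
    intro k; rw [hcdef]; exact Real.rpow_nonneg (Nat.cast_nonneg k) _
  have hc1 : ∀ k, 1 ≤ k → 1 ≤ c k := by
    intro k hk; rw [hcdef]; exact Real.one_le_rpow (by exact_mod_cast hk) (by norm_num)
  clear hcdef hr
  set M := Nat.sqrt n with hMdef
  have hM : ∀ x, x * x ≤ n → x ≤ M := fun x hx => Nat.le_sqrt.2 hx
  have hMr : (M : ℝ) ≤ r ^ 3 := by
    have h1 : (M : ℝ) * M ≤ n := by exact_mod_cast Nat.sqrt_le n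
    rw [← hr6] at h1
    apply le_of_sq_le_sq _ (by positivity)
    nlinarith
  have hM1 : 1 ≤ M := hM 1 (by omega)
  have hcM : c M ≤ r := by
    apply le_of_pow_le_pow_left₀ (n := 3) (by norm_num) hr0.le
    rw [hc3]; exact hMr
  have hcM2 : r ≤ 2 * c M := by
    apply le_of_pow_le_pow_left₀ (n := 3) (by norm_num) (by linarith [hc0 M])
    rw [mul_pow, hc3]
    have h1 : (n : ℝ) ≤ (M + 1) * (M + 1) := by
      exact_mod_cast (Nat.lt_succ_sqrt n).le
    have hM1' : (1 : ℝ) ≤ M := by exact_mod_cast hM1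
    rw [← hr6] at h1
    have : r ^ 3 ≤ M + 1 := by
      apply le_of_sq_le_sq _ (by positivity)
      nlinarith
    linarith
  -- the weights
  have hstep : ∀ k : ℕ, 1 ≤ k → c k ≤ c (k + 1) ∧
      c (k + 1) ^ 3 - c k ^ 3 = 1 := by
    intro k hk
    have h1 : c (k + 1) ^ 3 - c k ^ 3 = 1 := by rw [hc3, hc3]; push_cast; ring
    refine ⟨?_, h1⟩
    apply le_of_pow_le_pow_left₀ (n := 3) (by norm_num) (hc0 _)
    linarith
  have h0 : c 0 = 0 := by
    have := hc3 0
    simpa using this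
  have hmain := upper_comb hM hA hg (fun w => r ^ 6 / (max (c w) r) ^ 4)
    (fun z => 6 * (r ^ 4 / c z ^ 8)) ?_ ?_ ?_
  · have hS1 : ((((Finset.Icc 1 n).filter (fun w => w ^ 3 ≤ n ^ 2)).card : ℕ) : ℝ) ≤ r ^ 5 := by
      have h1 : (Finset.Icc 1 n).filter (fun w => w ^ 3 ≤ n ^ 2) ⊆ Finset.Icc 1 ⌊r ^ 4⌋₊ := by
        intro w hw
        obtain ⟨h1, h2⟩ := Finset.mem_filter.1 hw
        refine Finset.mem_Icc.2 ⟨(Finset.mem_Icc.1 h1).1, Nat.le_floor ?_⟩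
        apply le_of_pow_le_pow_left₀ (n := 3) (by norm_num) (by positivity)
        have h3 : (w : ℝ) ^ 3 ≤ (n : ℝ) ^ 2 := by exact_mod_cast h2
        rw [← hr6] at h3
        calc (w : ℝ) ^ 3 ≤ (r ^ 6) ^ 2 := h3
          _ = (r ^ 4) ^ 3 := by ring
      have h2 := Finset.card_le_card h1
      rw [Nat.card_Icc] at h2
      calc ((((Finset.Icc 1 n).filter (fun w => w ^ 3 ≤ n ^ 2)).card : ℕ) : ℝ)
          ≤ (⌊r ^ 4⌋₊ : ℝ) := by exact_mod_cast (by omega)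
        _ ≤ r ^ 4 := Nat.floor_le (by positivity)
        _ ≤ r ^ 5 := pow_le_pow_right₀ hr1 (by norm_num)
    have hS2 : ∑ w ∈ Finset.Icc 1 n, r ^ 6 / (max (c w) r) ^ 4 ≤ 7 * r ^ 5 := by
      have hcMpos : 0 < c M := by linarith [hc1 M hM1]
      have hA1 : ∑ w ∈ Finset.Icc 1 M, r ^ 6 / (max (c w) r) ^ 4 ≤ r ^ 5 := by
        calc ∑ w ∈ Finset.Icc 1 M, r ^ 6 / (max (c w) r) ^ 4
            ≤ ∑ w ∈ Finset.Icc 1 M, r ^ 2 := by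
              apply Finset.sum_le_sum
              intro w _
              rw [div_le_iff₀ (by positivity)]
              have : r ^ 4 ≤ (max (c w) r) ^ 4 := by gcongr; exact le_max_right _ _
              nlinarith [pow_pos hr0 2]
          _ = M * r ^ 2 := by simp
          _ ≤ r ^ 3 * r ^ 2 := by gcongr
          _ = r ^ 5 := by ring
      have hB : ∀ k, M ≤ k → ∑ w ∈ Finset.Icc 1 k, r ^ 6 / (max (c w) r) ^ 4 ≤
          r ^ 5 + 3 * r ^ 6 * (1 / c M - 1 / c k) := by
        intro k hk
        induction k, hk using Nat.le_induction with
        | base => simpa using hA1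
        | succ k hk ih =>
          rw [Finset.sum_Icc_succ_top (by omega)]
          have hk1 : 1 ≤ k := by omega
          obtain ⟨e1, e2⟩ := hstep k hk1
          have e3 := hc1 k hk1
          have e4 : r ^ 6 / (max (c (k+1)) r) ^ 4 ≤ r ^ 6 / (c (k+1)) ^ 4 := by
            have : 0 < c (k + 1) := by linarith
            gcongr
            exact le_max_left _ _
          have e5 : 1 / c (k+1) ^ 4 ≤ 3 * (1 / c k - 1 / c (k+1)) := by
            set a := c (k+1)
            set b := c k
            have hb : 0 < b := by linarith
            have ha : 0 < a := by linarith
            have e6 : 1 / b - 1 / a = 1 / (a * b * (a ^ 2 + a * b + b ^ 2)) := by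
              have : (a - b) * (a ^ 2 + a * b + b ^ 2) = 1 := by rw [← e2]; ring
              rw [div_sub_div _ _ hb.ne' ha.ne', div_eq_div_iff (by positivity) (by positivity)]
              linear_combination (a * b) * this
            rw [e6, mul_one_div, div_le_div_iff₀ (by positivity) (by positivity)]
            have h1 : a * b ≤ a ^ 2 := by nlinarith
            have h2 : b ^ 2 ≤ a ^ 2 := by gcongr
            have h3 : a * b * (a ^ 2 + a * b + b ^ 2) ≤ a ^ 2 * (a ^ 2 + a ^ 2 + a ^ 2) := by
              gcongr
            linarith [h3]
          have e7 : r ^ 6 / (c (k+1)) ^ 4 ≤ 3 * r ^ 6 * (1 / c k - 1 / c (k+1)) := by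
            calc r ^ 6 / (c (k+1)) ^ 4 = r ^ 6 * (1 / c (k+1) ^ 4) := by ring
              _ ≤ r ^ 6 * (3 * (1 / c k - 1 / c (k+1))) := by gcongr
              _ = _ := by ring
          linarith
      have hMn : M ≤ n := Nat.sqrt_le_self n
      have hfin := hB n hMn
      have h1 : 0 ≤ 1 / c n := by have := hc0 n; positivity
      have h2 : 1 / c M ≤ 2 / r := by
        rw [div_le_div_iff₀ hcMpos hr0]; linarith
      have h3 : 3 * r ^ 6 * (1 / c M - 1 / c n) ≤ 3 * r ^ 6 * (2 / r) := by
        gcongr; linarith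
      have h4 : 3 * r ^ 6 * (2 / r) = 6 * r ^ 5 := by field_simp; ring
      linarith
    have hS3 : ∑ z ∈ Finset.Icc 1 M, (z : ℝ) ^ 2 * (6 * (r ^ 4 / c z ^ 8)) ≤ 18 * r ^ 5 := by
      have hB : ∀ k : ℕ, ∑ z ∈ Finset.Icc 1 k, (z : ℝ) ^ 2 * (6 * (r ^ 4 / c z ^ 8)) ≤
          18 * r ^ 4 * c k := by
        intro k
        induction k with
        | zero => simp [h0]
        | succ k ih =>
          rw [Finset.sum_Icc_succ_top (by omega)]
          have ha := hc1 (k+1) (by omega)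
          have hb := hc0 k
          have e1 : c (k + 1) ^ 3 - c k ^ 3 = 1 := by rw [hc3, hc3]; push_cast; ring
          have e2 : c k ≤ c (k+1) := by
            apply le_of_pow_le_pow_left₀ (n := 3) (by norm_num) (hc0 _)
            linarith
          rw [← hc3 (k+1)]
          set a := c (k+1)
          set b := c k
          have ha0 : 0 < a := by linarith
          have e3 : (a ^ 3) ^ 2 * (6 * (r ^ 4 / a ^ 8)) = 6 * r ^ 4 * (1 / a ^ 2) := by
            field_simp
          have e4 : 1 / a ^ 2 ≤ 3 * (a - b) := by
            rw [div_le_iff₀ (by positivity)]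
            have h1 : a * b ≤ a ^ 2 := by nlinarith
            have h2 : b ^ 2 ≤ a ^ 2 := by gcongr
            have h3 : (a - b) * (a ^ 2 + a * b + b ^ 2) = 1 := by rw [← e1]; ring
            have h4 : 0 ≤ a - b := by linarith
            nlinarith
          rw [e3]
          have e5 : 6 * r ^ 4 * (1 / a ^ 2) ≤ 6 * r ^ 4 * (3 * (a - b)) := by gcongr
          linarith
      refine (hB M).trans ?_
      calc 18 * r ^ 4 * c M ≤ 18 * r ^ 4 * r := by gcongr
        _ = 18 * r ^ 5 := by ring
    have : 0 < r ^ 5 := by positivity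
    linarith
  · intro w hw
    have : 0 < max (c w) r := lt_max_of_lt_right hr0
    positivity
  · intro z
    have := hc0 z
    positivity
  · intro w z hw hz hzz hwz
    have hz1 := hc1 z hz
    have hz0 : 0 < c z := by linarith
    have hw0 := hc0 w
    have hmax : max (c w) r ≤ r ^ 2 / c z := by
      apply max_le
      · rw [le_div_iff₀ hz0]
        apply le_of_pow_le_pow_left₀ (n := 3) (by norm_num) (by positivity)
        rw [mul_pow, hc3, hc3]
        have : (w : ℝ) * z ≤ n := by exact_mod_cast hwz
        calc (w : ℝ) * z ≤ n := this
          _ = (r ^ 2) ^ 3 := by rw [← hr6]; ring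
      · rw [le_div_iff₀ hz0]
        have : c z ≤ r := by
          apply le_of_pow_le_pow_left₀ (n := 3) (by norm_num) hr0.le
          rw [hc3]
          have : (z : ℝ) ≤ M := by exact_mod_cast hM z hzz
          linarith
        nlinarith
    have hmp : 0 < max (c w) r := lt_max_of_lt_right hr0
    generalize max (c w) r = m at *
    calc 6 / (r ^ 6 / m ^ 4) ^ 2 = 6 * (m ^ 8 / r ^ 12) := by field_simp
      _ ≤ 6 * ((r ^ 2 / c z) ^ 8 / r ^ 12) := by gcongr
      _ = 6 * (r ^ 4 / c z ^ 8) := by field_simp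

lemma graph_bound {L R : Type*} [DecidableEq L] [DecidableEq R] (T : Finset (L × R))
    (hC : ∀ l l' r r', (l, r) ∈ T → (l, r') ∈ T → (l', r) ∈ T → (l', r') ∈ T → l = l' ∨ r = r')
    (hL : ∀ l, 3 ∣ (T.filter (fun e => e.1 = l)).card)
    (hR : ∀ r, 3 ∣ (T.filter (fun e => e.2 = r)).card) (hne : T.Nonempty) : 21 ≤ T.card := by
  have hL3 : ∀ e ∈ T, 3 ≤ (T.filter (fun e' => e'.1 = e.1)).card := by
    intro e he
    refine Nat.le_of_dvd (Finset.card_pos.2 ⟨e, ?_⟩) (hL _)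
    simp [he]
  have hR3 : ∀ e ∈ T, 3 ≤ (T.filter (fun e' => e'.2 = e.2)).card := by
    intro e he
    refine Nat.le_of_dvd (Finset.card_pos.2 ⟨e, ?_⟩) (hR _)
    simp [he]
  obtain ⟨e0, he0⟩ := hne
  set l0 := e0.1 with hl0
  set X := T.filter (fun e => e.1 = l0) with hX
  have hX3 : 3 ≤ X.card := hL3 e0 he0
  -- second neighbourhood
  set Y : L × R → Finset L := fun e => ((T.filter (fun e' => e'.2 = e.2)).image Prod.fst).erase l0
    with hY
  have hYmem : ∀ e l, l ∈ Y e ↔ l ≠ l0 ∧ (l, e.2) ∈ T := by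
    intro e l
    simp only [hY, Finset.mem_erase, Finset.mem_image, Finset.mem_filter]
    constructor
    · rintro ⟨h1, ⟨a, b⟩, ⟨h2, h3⟩, h4⟩
      simp only at h3 h4
      subst h3 h4
      exact ⟨h1, h2⟩
    · rintro ⟨h1, h2⟩
      exact ⟨h1, (l, e.2), ⟨h2, rfl⟩, rfl⟩
  have hY2 : ∀ e ∈ X, 2 ≤ (Y e).card := by
    intro e he
    have heT := (Finset.mem_filter.1 he).1
    have h1 := hR3 e heT
    have h2 : ((T.filter (fun e' => e'.2 = e.2)).image Prod.fst).card
        = (T.filter (fun e' => e'.2 = e.2)).card := by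
      apply Finset.card_image_of_injOn
      intro a ha b hb hab
      have ha' := (Finset.mem_filter.1 ha).2
      have hb' := (Finset.mem_filter.1 hb).2
      exact Prod.ext hab (ha'.trans hb'.symm)
    have h3 := Finset.pred_card_le_card_erase
      (s := (T.filter (fun e' => e'.2 = e.2)).image Prod.fst) (a := l0)
    have h4 : (Y e).card = (((T.filter (fun e' => e'.2 = e.2)).image Prod.fst).erase l0).card := rfl
    omega
  have hdisj : ∀ e ∈ X, ∀ e' ∈ X, e ≠ e' → Disjoint (Y e) (Y e') := by
    intro e he e' he' hne
    rw [Finset.disjoint_left]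
    intro l hl hl'
    obtain ⟨h1, h2⟩ := (hYmem e l).1 hl
    obtain ⟨-, h3⟩ := (hYmem e' l).1 hl'
    obtain ⟨h4, h5⟩ := Finset.mem_filter.1 he
    obtain ⟨h6, h7⟩ := Finset.mem_filter.1 he'
    have h4' : (l0, e.2) ∈ T := by rw [← h5]; exact h4
    have h6' : (l0, e'.2) ∈ T := by rw [← h7]; exact h6
    rcases hC l l0 e.2 e'.2 h2 h3 h4' h6' with h | h
    · exact h1 h
    · exact hne (Prod.ext (h5.trans h7.symm) h)
  have hU : 6 ≤ (X.biUnion Y).card := by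
    rw [Finset.card_biUnion (fun e he e' he' h => hdisj e he e' he' h)]
    have := Finset.card_nsmul_le_sum X (fun e => (Y e).card) 2 hY2
    rw [smul_eq_mul] at this
    omega
  have hI : 7 ≤ (T.image Prod.fst).card := by
    have hsub : insert l0 (X.biUnion Y) ⊆ T.image Prod.fst := by
      intro l hl
      rcases Finset.mem_insert.1 hl with h | h
      · rw [h]; exact Finset.mem_image_of_mem _ he0
      · obtain ⟨e, -, he⟩ := Finset.mem_biUnion.1 h
        exact Finset.mem_image.2 ⟨_, ((hYmem e l).1 he).2, rfl⟩
    have hnot : l0 ∉ X.biUnion Y := by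
      intro h
      obtain ⟨e, -, he⟩ := Finset.mem_biUnion.1 h
      exact ((hYmem e l0).1 he).1 rfl
    have h1 := Finset.card_le_card hsub
    rw [Finset.card_insert_of_notMem hnot] at h1
    omega
  rw [Finset.card_eq_sum_card_image Prod.fst T]
  have := Finset.card_nsmul_le_sum (T.image Prod.fst)
    (fun b => (T.filter (fun e => e.1 = b)).card) 3 (by
      intro b hb
      obtain ⟨e, he, rfl⟩ := Finset.mem_image.1 hb
      exact hL3 e he)
  rw [smul_eq_mul] at this
  omega

lemma lower_comb (n m q : ℕ) [Fact q.Prime] (hm2 : 2 ≤ m) (hm : m * m ≤ n)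
    (hq : 2 * q ^ 2 ≤ Nat.primeCounting m) :
    Nat.primeCounting n + Nat.primeCounting (n / 2) + q ^ 3 ≤ Fkd 18 3 n + 2 * m := by
  classical
  -- primes labelling the vertices
  obtain ⟨f⟩ : Nonempty (((ZMod q × ZMod q) ⊕ (ZMod q × ZMod q)) ↪ (Nat.primesLE m)) := by
    apply Function.Embedding.nonempty_of_card_le
    rw [Fintype.card_coe, Nat.primesLE_card_eq_primeCounting]
    simp only [Fintype.card_sum, Fintype.card_prod, ZMod.card]
    nlinarith
  set F : ((ZMod q × ZMod q) ⊕ (ZMod q × ZMod q)) → ℕ := fun i => (f i : ℕ) with hF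
  have hFp : ∀ i, (F i).Prime := fun i => Nat.prime_of_mem_primesLE (f i).2
  have hFm : ∀ i, F i ≤ m := fun i => Nat.le_of_mem_primesLE (f i).2
  have hFi : ∀ i j, F i = F j → i = j := fun i j h => f.injective (Subtype.ext h)
  clear_value F
  set φ : (ZMod q × ZMod q) × (ZMod q × ZMod q) → ℕ :=
    fun e => F (Sum.inl e.1) * F (Sum.inr e.2) with hφ
  have hφ0 : ∀ e, φ e ≠ 0 := fun e => mul_ne_zero (hFp _).ne_zero (hFp _).ne_zero
  have hφl : ∀ e l, (φ e).factorization (F (Sum.inl l)) = if e.1 = l then 1 else 0 := by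
    intro e l
    simp only [hφ]
    rw [Nat.factorization_mul (hFp _).ne_zero (hFp _).ne_zero, (hFp _).factorization,
      (hFp _).factorization, Finsupp.add_apply, Finsupp.single_apply, Finsupp.single_apply]
    have h1 : F (Sum.inr e.2) ≠ F (Sum.inl l) := fun h => by simpa using hFi _ _ h
    have h2 : F (Sum.inl e.1) = F (Sum.inl l) ↔ e.1 = l :=
      ⟨fun h => by simpa using hFi _ _ h, fun h => by rw [h]⟩
    simp [h1, h2]
  have hφr : ∀ e l, (φ e).factorization (F (Sum.inr l)) = if e.2 = l then 1 else 0 := by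
    intro e l
    simp only [hφ]
    rw [Nat.factorization_mul (hFp _).ne_zero (hFp _).ne_zero, (hFp _).factorization,
      (hFp _).factorization, Finsupp.add_apply, Finsupp.single_apply, Finsupp.single_apply]
    have h1 : F (Sum.inl e.1) ≠ F (Sum.inr l) := fun h => by simpa using hFi _ _ h
    have h2 : F (Sum.inr e.2) = F (Sum.inr l) ↔ e.2 = l :=
      ⟨fun h => by simpa using hFi _ _ h, fun h => by rw [h]⟩
    simp [h1, h2]
  have hφinj : Function.Injective φ := by
    intro e e' h
    apply Prod.ext
    · have h1 := hφl e e.1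
      rw [h, hφl e' e.1] at h1
      by_contra hc
      rw [if_neg (fun h => hc h.symm)] at h1
      simp at h1
    · have h1 := hφr e e.2
      rw [h, hφr e' e.2] at h1
      by_contra hc
      rw [if_neg (fun h => hc h.symm)] at h1
      simp at h1
  -- the incidence graph
  set G : Finset ((ZMod q × ZMod q) × (ZMod q × ZMod q)) :=
    (Finset.univ : Finset (ZMod q × ZMod q × ZMod q)).image
      (fun z => ((z.1, z.2.1 * z.1 + z.2.2), (z.2.1, z.2.2))) with hG
  have hGcard : G.card = q ^ 3 := by
    rw [hG, Finset.card_image_of_injective]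
    · simp only [Finset.card_univ, Fintype.card_prod, ZMod.card]; ring
    · rintro ⟨a, b, c⟩ ⟨a', b', c'⟩ h
      simp only [Prod.mk.injEq] at h ⊢
      tauto
  have hGmem : ∀ x y k b, ((x, y), (k, b)) ∈ G → y = k * x + b := by
    intro x y k b h
    obtain ⟨⟨x', k', b'⟩, -, h⟩ := Finset.mem_image.1 h
    simp only [Prod.mk.injEq] at h
    obtain ⟨⟨rfl, rfl⟩, rfl, rfl⟩ := h
    rfl
  have hGC : ∀ l l' r r', (l, r) ∈ G → (l, r') ∈ G → (l', r) ∈ G → (l', r') ∈ G →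
      l = l' ∨ r = r' := by
    rintro ⟨x, y⟩ ⟨x', y'⟩ ⟨k, b⟩ ⟨k', b'⟩ h1 h2 h3 h4
    have e1 := hGmem _ _ _ _ h1
    have e2 := hGmem _ _ _ _ h2
    have e3 := hGmem _ _ _ _ h3
    have e4 := hGmem _ _ _ _ h4
    by_cases hx : x = x'
    · left
      subst hx
      rw [e1, e3]
    · right
      have hk : (k - k') * (x - x') = 0 := by linear_combination (-1) * e1 + e2 + e3 - e4
      rcases mul_eq_zero.1 hk with h | h
      · have hk' : k = k' := sub_eq_zero.1 h
        subst hk'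
        have : b = b' := by linear_combination (-1) * e1 + e2
        rw [this]
      · exact absurd (sub_eq_zero.1 h) hx
  clear_value G
  set P1 := (Nat.primesLE n).filter (fun p => m < p) with hP1
  set P2 := ((Nat.primesLE (n / 2)).filter (fun p => m < p)).image (fun p => 2 * p) with hP2
  set E := G.image φ with hE
  have hEcard : E.card = q ^ 3 := by
    rw [hE, Finset.card_image_of_injective _ hφinj, hGcard]
  have hP1card : Nat.primeCounting n ≤ P1.card + m := by
    rw [hP1, ← Nat.primesLE_card_eq_primeCounting]
    have h1 := Finset.card_filter_add_card_filter_not (s := Nat.primesLE n) (fun p => m < p)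
    have h2 : ((Nat.primesLE n).filter (fun p => ¬ m < p)).card ≤ m := by
      have : (Nat.primesLE n).filter (fun p => ¬ m < p) ⊆ Finset.Icc 1 m := by
        intro p hp
        obtain ⟨h3, h4⟩ := Finset.mem_filter.1 hp
        exact Finset.mem_Icc.2 ⟨(Nat.prime_of_mem_primesLE h3).one_le, by omega⟩
      simpa using Finset.card_le_card this
    omega
  have hP2card : Nat.primeCounting (n / 2) ≤ P2.card + m := by
    rw [hP2, Finset.card_image_of_injective _ (fun a b h => by simpa using h)]
    rw [← Nat.primesLE_card_eq_primeCounting]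
    have h1 := Finset.card_filter_add_card_filter_not (s := Nat.primesLE (n / 2)) (fun p => m < p)
    have h2 : ((Nat.primesLE (n / 2)).filter (fun p => ¬ m < p)).card ≤ m := by
      have : (Nat.primesLE (n / 2)).filter (fun p => ¬ m < p) ⊆ Finset.Icc 1 m := by
        intro p hp
        obtain ⟨h3, h4⟩ := Finset.mem_filter.1 hp
        exact Finset.mem_Icc.2 ⟨(Nat.prime_of_mem_primesLE h3).one_le, by omega⟩
      simpa using Finset.card_le_card this
    omega
  have hP1m : ∀ a ∈ P1, a.Prime ∧ m < a ∧ a ≤ n := by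
    intro a ha
    obtain ⟨h1, h2⟩ := Finset.mem_filter.1 ha
    exact ⟨Nat.prime_of_mem_primesLE h1, h2, Nat.le_of_mem_primesLE h1⟩
  have hP2m : ∀ a ∈ P2, ∃ p, p.Prime ∧ m < p ∧ a = 2 * p ∧ a ≤ n := by
    intro a ha
    obtain ⟨p, hp, rfl⟩ := Finset.mem_image.1 ha
    obtain ⟨h1, h2⟩ := Finset.mem_filter.1 hp
    refine ⟨p, Nat.prime_of_mem_primesLE h1, h2, rfl, ?_⟩
    have := Nat.le_of_mem_primesLE h1
    omega
  have hEnd : ∀ a ∈ E, ∀ p, p.Prime → m < p → ¬ p ∣ a := by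
    intro a ha p hp hmp hd
    obtain ⟨e, -, rfl⟩ := Finset.mem_image.1 ha
    rcases (Nat.Prime.dvd_mul hp).1 hd with h | h
    · have := Nat.le_of_dvd (hFp _).pos h
      have := hFm (Sum.inl e.1)
      omega
    · have := Nat.le_of_dvd (hFp _).pos h
      have := hFm (Sum.inr e.2)
      omega
  have hd12 : Disjoint P1 P2 := by
    rw [Finset.disjoint_left]
    intro a h1 h2
    obtain ⟨p, hp, h3, h4, -⟩ := hP2m a h2
    have h5 := (hP1m a h1).1
    rw [h4] at h5
    exact Nat.not_prime_mul (by norm_num) hp.one_lt.ne' h5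
  have hd3 : Disjoint (P1 ∪ P2) E := by
    rw [Finset.disjoint_left]
    intro a h1 h2
    rcases Finset.mem_union.1 h1 with h | h
    · obtain ⟨h3, h4, -⟩ := hP1m a h
      exact hEnd a h2 a h3 h4 dvd_rfl
    · obtain ⟨p, hp, h3, h4, -⟩ := hP2m a h
      exact hEnd a h2 p hp h3 ⟨2, by rw [h4]; ring⟩
  have hAcard : ((P1 ∪ P2) ∪ E).card = P1.card + P2.card + q ^ 3 := by
    rw [Finset.card_union_of_disjoint hd3, Finset.card_union_of_disjoint hd12, hEcard]
  have hAsub : (P1 ∪ P2) ∪ E ⊆ Finset.Icc 1 n := by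
    intro a ha
    rw [Finset.mem_Icc]
    rcases Finset.mem_union.1 ha with h | h
    · rcases Finset.mem_union.1 h with h | h
      · obtain ⟨h3, h4, h5⟩ := hP1m a h
        exact ⟨h3.one_le, h5⟩
      · obtain ⟨p, hp, h3, h4, h5⟩ := hP2m a h
        have := hp.one_le
        exact ⟨by omega, h5⟩
    · obtain ⟨e, -, rfl⟩ := Finset.mem_image.1 h
      refine ⟨Nat.pos_of_ne_zero (hφ0 e), ?_⟩
      exact (Nat.mul_le_mul (hFm _) (hFm _)).trans hm
  -- large primes
  have hlarge : ∀ a ∈ (P1 ∪ P2) ∪ E, ∀ p, p.Prime → m < p → p ∣ a → a = p ∨ a = 2 * p := by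
    intro a ha p hp hmp hd
    rcases Finset.mem_union.1 ha with h | h
    · rcases Finset.mem_union.1 h with h | h
      · left
        exact ((Nat.prime_dvd_prime_iff_eq hp (hP1m a h).1).1 hd).symm
      · right
        obtain ⟨p', hp', h3, h4, h5⟩ := hP2m a h
        rw [h4] at hd
        rcases (Nat.Prime.dvd_mul hp).1 hd with h | h
        · have := Nat.le_of_dvd (by norm_num) h
          omega
        · rw [h4, (Nat.prime_dvd_prime_iff_eq hp hp').1 h]
    · exact absurd hd (hEnd a h p hp hmp)
  have hgood : GoodS ((P1 ∪ P2) ∪ E) := by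
    intro S hS hScard x hx hprod
    have hS0 : ∀ a ∈ S, a ≠ 0 := by
      intro a ha
      have := (Finset.mem_Icc.1 (hAsub (hS ha))).1
      omega
    have hfac : ∀ p, ∑ a ∈ S, a.factorization p = 3 * x.factorization p := by
      intro p
      rw [← Nat.factorization_prod_apply hS0, hprod, Nat.factorization_pow]
      simp
    have hno : ∀ p, p.Prime → m < p → ∀ a ∈ S, ¬ p ∣ a := by
      intro p hp hmp a ha hd
      have hp2 : ¬ p ∣ 2 := fun h => by
        have := Nat.le_of_dvd (by norm_num) h
        omega
      have h1 : ∑ b ∈ S, b.factorization p = (S.filter (fun b => p ∣ b)).card := by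
        rw [Finset.card_filter]
        apply Finset.sum_congr rfl
        intro b hb
        split_ifs with h
        · rcases hlarge b (hS hb) p hp hmp h with h | h
          · rw [h]; exact hp.factorization_self
          · rw [h, Nat.factorization_mul (by norm_num) hp.ne_zero, Finsupp.add_apply,
              hp.factorization_self, Nat.factorization_eq_zero_of_not_dvd hp2]
        · exact Nat.factorization_eq_zero_of_not_dvd h
      have h2 : (S.filter (fun b => p ∣ b)).card ≤ 2 := by
        have : S.filter (fun b => p ∣ b) ⊆ {p, 2 * p} := by
          intro b hb
          obtain ⟨h3, h4⟩ := Finset.mem_filter.1 hb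
          simpa using hlarge b (hS h3) p hp hmp h4
        exact (Finset.card_le_card this).trans Finset.card_le_two
      have h3 : 0 < (S.filter (fun b => p ∣ b)).card :=
        Finset.card_pos.2 ⟨a, Finset.mem_filter.2 ⟨ha, hd⟩⟩
      have := hfac p
      omega
    have hSE : S ⊆ E := by
      intro a ha
      rcases Finset.mem_union.1 (hS ha) with h | h
      · exfalso
        rcases Finset.mem_union.1 h with h | h
        · obtain ⟨h3, h4, -⟩ := hP1m a h
          exact hno a h3 h4 a ha dvd_rfl
        · obtain ⟨p, hp, h3, h4, -⟩ := hP2m a h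
          exact hno p hp h3 a ha ⟨2, by rw [h4]; ring⟩
      · exact h
    set T := G.filter (fun e => φ e ∈ S) with hT
    have hTS : T.image φ = S := by
      ext a
      simp only [hT, Finset.mem_image, Finset.mem_filter]
      constructor
      · rintro ⟨e, ⟨_, h⟩, rfl⟩; exact h
      · intro ha
        obtain ⟨e, he, rfl⟩ := Finset.mem_image.1 (hSE ha)
        exact ⟨e, ⟨he, ha⟩, rfl⟩
    have hTcard : T.card = 18 := by
      rw [← hScard, ← hTS, Finset.card_image_of_injective _ hφinj]
    have hfacT : ∀ p, ∑ e ∈ T, (φ e).factorization p = 3 * x.factorization p := by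
      intro p
      rw [← hfac p, ← hTS, Finset.sum_image (fun a _ b _ h => hφinj h)]
    have hTG : ∀ e, e ∈ T → e ∈ G := fun e he => (Finset.mem_filter.1 he).1
    have := graph_bound T
      (fun l l' r r' a b c d => hGC l l' r r' (hTG _ a) (hTG _ b) (hTG _ c) (hTG _ d))
      (fun l => by
        rw [Finset.card_filter]
        refine ⟨x.factorization (F (Sum.inl l)), ?_⟩
        rw [← hfacT]
        exact Finset.sum_congr rfl fun e _ => (hφl e l).symm)
      (fun l => by
        rw [Finset.card_filter]
        refine ⟨x.factorization (F (Sum.inr l)), ?_⟩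
        rw [← hfacT]
        exact Finset.sum_congr rfl fun e _ => (hφr e l).symm)
      (Finset.card_pos.1 (by omega))
    omega
  have := le_Fkd hAsub hgood
  omega

lemma pi_large : ∀ᶠ m : ℕ in Filter.atTop,
    64 * (m : ℝ) ^ ((8 : ℝ)/9) ≤ (Nat.primeCounting m : ℝ) := by
  have h1 := (isLittleO_log_rpow_atTop (show (0 : ℝ) < 1 / 9 by norm_num)).bound
    (show (0 : ℝ) < 1 / 200 by norm_num)
  have h2 := tendsto_natCast_atTop_atTop (R := ℝ) |>.eventually h1
  filter_upwards [h2, Filter.eventually_ge_atTop 3] with m hm hm3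
  have hm3' : (3 : ℝ) ≤ m := by exact_mod_cast hm3
  have hm0 : (0 : ℝ) < m := by linarith
  have hlog : 0 < Real.log m := Real.log_pos (by linarith)
  rw [Real.norm_of_nonneg hlog.le, Real.norm_of_nonneg (by positivity)] at hm
  have hpi := Chebyshev.pi_ge m
  refine le_trans ?_ hpi
  rw [le_div_iff₀ hlog]
  have e1 : (m : ℝ) ^ ((8 : ℝ)/9) * (m : ℝ) ^ ((1 : ℝ)/9) = m := by
    rw [← Real.rpow_add hm0]; norm_num
  have e2 : (m : ℝ) ^ ((1 : ℝ)/9) ≤ m := by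
    calc (m : ℝ) ^ ((1 : ℝ)/9) ≤ (m : ℝ) ^ (1 : ℝ) :=
          Real.rpow_le_rpow_of_exponent_le (by linarith) (by norm_num)
      _ = m := Real.rpow_one _
  have e3 : Real.log (m + 1) ≤ 2 * Real.log m := by
    have : Real.log (m + 1) ≤ Real.log ((m : ℝ) ^ 2) :=
      Real.log_le_log (by linarith) (by nlinarith)
    rw [Real.log_pow] at this
    exact_mod_cast this
  have e4 : 64 * (m : ℝ) ^ ((8 : ℝ)/9) * Real.log m ≤
      64 * (m : ℝ) ^ ((8 : ℝ)/9) * (1 / 200 * (m : ℝ) ^ ((1 : ℝ)/9)) := by gcongr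
  have e5 : 64 * (m : ℝ) ^ ((8 : ℝ)/9) * (1 / 200 * (m : ℝ) ^ ((1 : ℝ)/9)) = 64 / 200 * m := by
    linear_combination (64 / 200 : ℝ) * e1
  have := Real.log_two_gt_d9
  nlinarith

lemma lower_bound : ∀ᶠ n : ℕ in Filter.atTop,
    (Nat.primeCounting n : ℝ) + (Nat.primeCounting (n / 2) : ℝ)
        + 1 * (n : ℝ) ^ ((2 : ℝ)/3) / (Real.log n) ^ ((4 : ℝ)/3)
        ≤ (Fkd 18 3 n : ℝ) := by
  have hsq : Tendsto Nat.sqrt atTop atTop := by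
    apply Filter.tendsto_atTop_atTop.2
    intro b
    exact ⟨b * b, fun a ha => Nat.le_sqrt.2 ha⟩
  filter_upwards [hsq.eventually pi_large, Filter.eventually_ge_atTop 4] with n hn hn4
  set m := Nat.sqrt n with hm
  have hmm : m * m ≤ n := Nat.sqrt_le n
  have hm2 : 2 ≤ m := Nat.le_sqrt.2 (by omega)
  have hnR : (4 : ℝ) ≤ n := by exact_mod_cast hn4
  have hn0 : (0 : ℝ) ≤ n := by linarith
  have hm2R : (2 : ℝ) ≤ m := by exact_mod_cast hm2
  obtain ⟨t, ht⟩ : ∃ t : ℝ, t = (n : ℝ) ^ ((2 : ℝ)/9) := ⟨_, rfl⟩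
  have ht1 : 1 ≤ t := by rw [ht]; exact Real.one_le_rpow (by linarith) (by norm_num)
  have ht3 : t ^ 3 = (n : ℝ) ^ ((2 : ℝ)/3) := by
    rw [ht, ← Real.rpow_natCast, ← Real.rpow_mul hn0]; norm_num
  have ht2 : t ^ 2 = (n : ℝ) ^ ((4 : ℝ)/9) := by
    rw [ht, ← Real.rpow_natCast, ← Real.rpow_mul hn0]; norm_num
  obtain ⟨q, hqp, hq1, hq2⟩ := Nat.exists_prime_lt_and_le_two_mul ⌊2 * t⌋₊
    (Nat.floor_pos.2 (by linarith)).ne'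
  have hq1' : 2 * t ≤ q := (Nat.lt_of_floor_lt hq1).le
  have hq2' : (q : ℝ) ≤ 4 * t := by
    have h1 : (q : ℝ) ≤ 2 * (⌊2 * t⌋₊ : ℝ) := by exact_mod_cast hq2
    have h2 := Nat.floor_le (show 0 ≤ 2 * t by linarith)
    linarith
  haveI : Fact q.Prime := ⟨hqp⟩
  have hnm : (n : ℝ) ^ ((4 : ℝ)/9) ≤ 2 * (m : ℝ) ^ ((8 : ℝ)/9) := by
    have h1 : (n : ℝ) ≤ (m + 1) * (m + 1) := by exact_mod_cast (Nat.lt_succ_sqrt n).le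
    have h2 : (n : ℝ) ≤ (3 / 2 * m) ^ (2 : ℝ) := by
      rw [Real.rpow_two]; nlinarith
    calc (n : ℝ) ^ ((4 : ℝ)/9) ≤ ((3 / 2 * (m : ℝ)) ^ (2 : ℝ)) ^ ((4 : ℝ)/9) := by gcongr
      _ = (3 / 2 * (m : ℝ)) ^ ((8 : ℝ)/9) := by
          rw [← Real.rpow_mul (by positivity)]; norm_num
      _ = (3 / 2 : ℝ) ^ ((8 : ℝ)/9) * (m : ℝ) ^ ((8 : ℝ)/9) := by
          rw [Real.mul_rpow (by norm_num) (by positivity)]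
      _ ≤ 2 * (m : ℝ) ^ ((8 : ℝ)/9) := by
          gcongr
          calc (3 / 2 : ℝ) ^ ((8 : ℝ)/9) ≤ (3 / 2 : ℝ) ^ (1 : ℝ) :=
                Real.rpow_le_rpow_of_exponent_le (by norm_num) (by norm_num)
            _ ≤ 2 := by norm_num
  have hqpi : 2 * q ^ 2 ≤ Nat.primeCounting m := by
    have : (2 : ℝ) * (q : ℝ) ^ 2 ≤ Nat.primeCounting m := by
      calc (2 : ℝ) * (q : ℝ) ^ 2 ≤ 2 * (4 * t) ^ 2 := by gcongr
        _ = 32 * t ^ 2 := by ring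
        _ ≤ 32 * (2 * (m : ℝ) ^ ((8 : ℝ)/9)) := by rw [ht2]; gcongr
        _ = 64 * (m : ℝ) ^ ((8 : ℝ)/9) := by ring
        _ ≤ _ := hn
    exact_mod_cast this
  have hmain := lower_comb n m q hm2 hmm hqpi
  have hmainR : (Nat.primeCounting n : ℝ) + Nat.primeCounting (n / 2) + (q : ℝ) ^ 3 ≤
      Fkd 18 3 n + 2 * m := by exact_mod_cast hmain
  have hmt : (m : ℝ) ≤ t ^ 3 := by
    have h1 : (m : ℝ) * m ≤ n := by exact_mod_cast hmm
    have h2 : (n : ℝ) ≤ (t ^ 3) ^ 2 := by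
      rw [ht3, ← Real.rpow_natCast, ← Real.rpow_mul hn0]
      calc (n : ℝ) = (n : ℝ) ^ (1 : ℝ) := (Real.rpow_one _).symm
        _ ≤ _ := Real.rpow_le_rpow_of_exponent_le (by linarith) (by norm_num)
    apply le_of_sq_le_sq _ (by positivity)
    nlinarith
  have hq3 : 8 * t ^ 3 ≤ (q : ℝ) ^ 3 := by
    calc 8 * t ^ 3 = (2 * t) ^ 3 := by ring
      _ ≤ (q : ℝ) ^ 3 := by gcongr
  have hlog1 : 1 ≤ Real.log n := by
    rw [Real.le_log_iff_exp_le (by linarith)]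
    linarith [Real.exp_one_lt_d9]
  have hdiv : 1 * (n : ℝ) ^ ((2 : ℝ)/3) / (Real.log n) ^ ((4 : ℝ)/3) ≤ t ^ 3 := by
    rw [one_mul, ht3]
    exact div_le_self (by positivity) (Real.one_le_rpow hlog1 (by norm_num))
  have : 0 < t ^ 3 := by positivity
  linarith

theorem stmt_13 : ∃ c1 c2 : ℝ, 0 < c1 ∧ 0 < c2 ∧ ∀ᶠ n : ℕ in Filter.atTop,
    (Nat.primeCounting n : ℝ) + (Nat.primeCounting (n / 2) : ℝ)
        + c1 * (n : ℝ) ^ ((2 : ℝ)/3) / (Real.log n) ^ ((4 : ℝ)/3)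
        ≤ (Fkd 18 3 n : ℝ) ∧
    (Fkd 18 3 n : ℝ)
        ≤ (Nat.primeCounting n : ℝ) + (Nat.primeCounting (n / 2) : ℝ)
            + c2 * (n : ℝ) ^ ((5 : ℝ)/6) := by
  refine ⟨1, 100, by norm_num, by norm_num, ?_⟩
  filter_upwards [lower_bound, Filter.eventually_ge_atTop 1] with n h1 h2
  exact ⟨h1, upper_bound n h2⟩
end

section
/- For every integer ℓ ≥ 2 there exist positive real constants c1, c2, c3, c4 (depending on ℓ) such that for every sufficiently large positive integer n: π(n) + c1·n^{3ℓ/(6ℓ−2)}/(log n)^{3ℓ/(3ℓ−1)} ≤ f_{6ℓ,3}(n) ≤ π(n) + c2·n^{2/3}·log n, and π(n) + c3·n^{(3ℓ+1)/(6ℓ)}/(log n)^{(3ℓ+1)/(3ℓ)} ≤ f_{6ℓ+3,3}(n) ≤ π(n) + c4·n^{2/3}·log n. -/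
open Finset Filter

/-- The multiset of the values of `a` can be partitioned into groups,
each consisting of `d` copies of a single number. -/
def TrivialSol (d : ℕ) {k : ℕ} (a : Fin k → ℕ) : Prop :=
  ∀ y : ℕ, d ∣ (List.ofFn a : Multiset ℕ).count y

/-- `fkd k d n` is the maximum cardinality of a set `A ⊆ {1,…,n}` such that whenever
`a_1, …, a_k ∈ A` (not necessarily distinct) and `a_1 ⋯ a_k = x ^ d` for a positive integer
`x`, the multiset of the `a_i` is trivial. -/
noncomputable def fkd (k d n : ℕ) : ℕ :=
  sSup {m : ℕ | ∃ A : Finset ℕ, A ⊆ Finset.Icc 1 n ∧ A.card = m ∧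
    ∀ (a : Fin k → ℕ) (x : ℕ), (∀ i, a i ∈ A) → 0 < x →
      (∏ i, a i) = x ^ d → TrivialSol d a}


theorem closed_walk {E L : Type*} {R : Type*} [DecidableEq L] (S : Finset E) (al : E → L) (be : E → R)
    (hS : S.Nonempty) (hal : ∀ e ∈ S, ∃ e' ∈ S, e ≠ e' ∧ al e' = al e)
    (hbe : ∀ e ∈ S, ∃ e' ∈ S, e ≠ e' ∧ be e' = be e) (T : ℕ) (hT : (S.image al).card ≤ T) :
    ∃ t, 1 ≤ t ∧ t ≤ T ∧ ∃ z z' : ℕ → E,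
      (∀ k < t, z k ≠ z' k ∧ al (z' k) = al (z k)) ∧
      (∀ k < t, z' k ≠ z (k+1) ∧ be (z (k+1)) = be (z' k)) ∧ z t = z 0 := by
  classical
  obtain ⟨e0, he0⟩ := hS
  choose! σ hσS hσn hσ using hal
  choose! τ hτS hτn hτ using hbe
  let y : ℕ → E := fun i => (fun e => τ (σ e))^[i] e0
  have ys : ∀ i, y (i+1) = τ (σ (y i)) := fun i => Function.iterate_succ_apply' _ _ _
  have yS : ∀ i, y i ∈ S := by
    intro i
    induction i with
    | zero => exact he0
    | succ i ih => rw [ys]; exact hτS _ (hσS _ ih)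
  have hex : ∃ m, 1 ≤ m ∧ m ≤ T ∧ ∃ i, al (y i) = al (y (i+m)) := by
    have : ∃ a ∈ Finset.range (T+1), ∃ b ∈ Finset.range (T+1), a ≠ b ∧ al (y a) = al (y b) := by
      apply Finset.exists_ne_map_eq_of_card_lt_of_maps_to (t := S.image al)
      · simp; omega
      · intro a _
        exact Finset.mem_coe.2 (Finset.mem_image_of_mem _ (yS a))
    obtain ⟨a, ha, b, hb, hab, h⟩ := this
    simp at ha hb
    rcases lt_or_gt_of_ne hab with h1 | h1
    · exact ⟨b - a, by omega, by omega, a, by rw [h]; congr 2; omega⟩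
    · exact ⟨a - b, by omega, by omega, b, by rw [← h]; congr 2; omega⟩
  obtain ⟨hm1, hmT, i, hi⟩ := Nat.find_spec hex
  have hmin := fun k (hk : k < Nat.find hex) => Nat.find_min hex hk
  set m := Nat.find hex with hm
  by_cases hc : σ (y i) = y (i+m)
  · -- case 2
    have hm2 : 2 ≤ m := by
      by_contra h
      have : m = 1 := by omega
      rw [this, ys] at hc
      exact hτn _ (hσS _ (yS i)) hc
    have hne : σ (y (i+m-1)) ≠ y (i+1) := by
      intro h
      have h3 : 3 ≤ m := by
        by_contra h'
        have h2 : m = 2 := by omega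
        rw [h2] at h
        exact hσn _ (yS _) h.symm
      apply hmin (m-2) (by omega)
      refine ⟨by omega, by omega, i+1, ?_⟩
      rw [← h, hσ _ (yS _)]
      congr 2; omega
    refine ⟨m-1, by omega, by omega, fun k => if k = m-1 then y (i+1) else y (i+1+k),
      fun k => σ (y (i+1+k)), ?_, ?_, ?_⟩
    · intro k hk; beta_reduce
      rw [if_neg (by omega)]
      exact ⟨hσn _ (yS _), hσ _ (yS _)⟩
    · intro k hk; beta_reduce
      by_cases h : k + 1 = m-1
      · rw [if_pos h]
        have e : i + 1 + k = i + m - 1 := by omega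
        rw [e]
        refine ⟨hne, ?_⟩
        rw [ys i, hτ _ (hσS _ (yS _)), hc]
        have : y (i+m) = τ (σ (y (i+m-1))) := by rw [← ys]; congr 1; omega
        rw [this, hτ _ (hσS _ (yS _))]
      · rw [if_neg h, ← add_assoc, ys]
        exact ⟨hτn _ (hσS _ (yS _)), hτ _ (hσS _ (yS _))⟩
    · simp
  · refine ⟨m, hm1, hmT, fun k => if k = m then y (i+1) else y (i+1+k),
      fun k => if k + 1 = m then σ (y i) else σ (y (i+1+k)), ?_, ?_, ?_⟩
    · intro k hk; beta_reduce
      rw [if_neg (by omega)]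
      by_cases h : k + 1 = m
      · rw [if_pos h]
        have e : i + 1 + k = i + m := by omega
        rw [e]
        exact ⟨fun h => hc h.symm, by rw [hσ _ (yS _), hi]⟩
      · rw [if_neg h]
        exact ⟨hσn _ (yS _), hσ _ (yS _)⟩
    · intro k hk; beta_reduce
      by_cases h : k + 1 = m
      · rw [if_pos h, if_pos h, ys]
        exact ⟨hτn _ (hσS _ (yS _)), hτ _ (hσS _ (yS _))⟩
      · rw [if_neg h, if_neg h, ← add_assoc, ys]
        exact ⟨hτn _ (hσS _ (yS _)), hτ _ (hσS _ (yS _))⟩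
    · simp

def NoClosed {E L R : Type*} (al : E → L) (be : E → R) (T : ℕ) : Prop :=
  ∀ (t : ℕ) (z z' : ℕ → E), 1 ≤ t → t ≤ T →
      (∀ k < t, z k ≠ z' k ∧ al (z' k) = al (z k)) →
      (∀ k < t, z' k ≠ z (k+1) ∧ be (z (k+1)) = be (z' k)) → z t = z 0 → False

theorem exists_other {E L : Type*} [Fintype E] [DecidableEq L] (al : E → L) (N : E → ℕ)
    (h : ∀ u, 3 ∣ ∑ e with al e = u, N e) (e : E) (he : ¬ 3 ∣ N e) :
    ∃ e', ¬ 3 ∣ N e' ∧ e ≠ e' ∧ al e' = al e := by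
  classical
  by_contra hcon
  push Not at hcon
  apply he
  have := h (al e)
  rw [← Finset.add_sum_erase _ _ (a := e) (by simp)] at this
  refine (Nat.dvd_add_left ?_).1 this
  apply Finset.dvd_sum
  intro e' he'
  simp at he'
  by_contra h3
  exact hcon e' h3 (fun h => he'.1 h.symm) he'.2

theorem weights_dvd {E L R : Type*} [Fintype E] [DecidableEq L] [DecidableEq R] (al : E → L) (be : E → R)
    (T : ℕ) (hno : NoClosed al be T) (N : E → ℕ) (hl : ∀ u, 3 ∣ ∑ e with al e = u, N e)
    (hr : ∀ u, 3 ∣ ∑ e with be e = u, N e) (hT : ∑ e, N e ≤ 3 * T) : ∀ e, 3 ∣ N e := by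
  classical
  by_contra hcon
  push Not at hcon
  obtain ⟨e0, he0⟩ := hcon
  let S : Finset E := univ.filter fun e => ¬ 3 ∣ N e
  have hcard : (S.image al).card ≤ T := by
    have h1 : ∑ u ∈ S.image al, 3 ≤ ∑ u ∈ S.image al, ∑ e ∈ S with al e = u, N e % 3 := by
      apply Finset.sum_le_sum
      intro u hu
      obtain ⟨e, he, rfl⟩ := Finset.mem_image.1 hu
      have hpos : 0 < ∑ e' ∈ S with al e' = al e, N e' % 3 := by
        apply Finset.sum_pos'
        · simp
        · exact ⟨e, by simp [he], by simp [S] at he; omega⟩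
      apply Nat.le_of_dvd hpos
      have h2 : ∑ e' ∈ S with al e' = al e, N e' % 3 = ∑ e' with al e' = al e, N e' % 3 := by
        apply Finset.sum_subset
        · intro x; simp
        · intro x hx hx'
          simp [S] at hx hx'
          by_contra h
          exact hx' (by omega) hx
      rw [h2, Nat.dvd_iff_mod_eq_zero, ← Finset.sum_nat_mod]
      exact Nat.mod_eq_zero_of_dvd (hl _)
    rw [Finset.sum_fiberwise_of_maps_to (fun e he => Finset.mem_image_of_mem _ he)] at h1
    have h2 : ∑ e ∈ S, N e % 3 ≤ ∑ e, N e :=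
      (Finset.sum_le_sum fun e _ => Nat.mod_le _ _).trans
        (Finset.sum_le_sum_of_subset (Finset.subset_univ _))
    simp at h1
    omega
  obtain ⟨t, h1, h2, z, z', h3, h4, h5⟩ := closed_walk S al be ⟨e0, by simp [S, he0]⟩
    (by
      intro e he
      simp [S] at he
      obtain ⟨e', h⟩ := exists_other al N hl e he
      exact ⟨e', by simp [S, h.1], h.2⟩)
    (by
      intro e he
      simp [S] at he
      obtain ⟨e', h⟩ := exists_other be N hr e he
      exact ⟨e', by simp [S, h.1], h.2⟩) T hcard
  exact hno t z z' h1 h2 h3 h4 h5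

theorem trivialSol_iff {d k : ℕ} (a : Fin k → ℕ) :
    TrivialSol d a ↔ ∀ y, d ∣ (univ.filter fun i => a i = y).card := by
  unfold TrivialSol
  refine forall_congr' fun y => ?_
  rw [← Fin.univ_val_map, Multiset.count_map]
  simp only [eq_comm (a := y)]
  rfl

theorem fkd_bdd (k d n : ℕ) : BddAbove {m : ℕ | ∃ A : Finset ℕ, A ⊆ Finset.Icc 1 n ∧ A.card = m ∧
    ∀ (a : Fin k → ℕ) (x : ℕ), (∀ i, a i ∈ A) → 0 < x →
      (∏ i, a i) = x ^ d → TrivialSol d a} := by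
  refine ⟨n, ?_⟩
  rintro m ⟨A, hA, rfl, -⟩
  simpa using Finset.card_le_card hA

theorem graph_to_set {E L R : Type*} [Fintype E] [Fintype L] [Fintype R] [DecidableEq L] [DecidableEq R]
    (al : E → L) (be : E → R) (T n : ℕ) (hT : 1 ≤ T) (hno : NoClosed al be T)
    (lab : L ⊕ R → ℕ) (hinj : Function.Injective lab) (hp : ∀ v, (lab v).Prime)
    (hle : ∀ v, lab v ^ 2 ≤ n) :
    Nat.primeCounting n + Fintype.card E ≤ fkd (3 * T) 3 n + (Fintype.card L + Fintype.card R) := by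
  classical
  let val : E → ℕ := fun e => lab (.inl (al e)) * lab (.inr (be e))
  have hfac : ∀ e p, (val e).factorization p =
      (if lab (.inl (al e)) = p then 1 else 0) + (if lab (.inr (be e)) = p then 1 else 0) := by
    intro e p
    simp only [val]
    rw [Nat.factorization_mul (hp _).ne_zero (hp _).ne_zero, (hp _).factorization, (hp _).factorization]
    simp [Finsupp.single_apply]
  have hval : Function.Injective val := by
    intro e e' h
    have h1 : al e = al e' := by
      have := hfac e (lab (.inl (al e)))
      rw [h, hfac] at this
      simp [hinj.eq_iff] at this
      by_contra hh
      simp [Ne.symm hh] at this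
    have h2 : be e = be e' := by
      have := hfac e (lab (.inr (be e)))
      rw [h, hfac] at this
      simp [hinj.eq_iff] at this
      by_contra hh
      simp [Ne.symm hh] at this
    by_contra hne
    refine hno 1 (fun _ => e) (fun _ => e') le_rfl hT ?_ ?_ rfl
    · intro k _; exact ⟨hne, h1.symm⟩
    · intro k _; exact ⟨Ne.symm hne, h2⟩
  let P : Finset ℕ := n.primesLE \ univ.image lab
  let Q : Finset ℕ := univ.image val
  have hPp : ∀ p ∈ P, p.Prime ∧ p ≤ n ∧ ∀ v, lab v ≠ p := by
    intro p hpP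
    simp only [P, Finset.mem_sdiff, Nat.mem_primesLE, Finset.mem_image, not_exists] at hpP
    exact ⟨hpP.1.2, hpP.1.1, fun v h => hpP.2 v ⟨Finset.mem_univ _, h⟩⟩
  have hdisj : Disjoint P Q := by
    rw [Finset.disjoint_left]
    intro p h1 h2
    obtain ⟨e, -, rfl⟩ := Finset.mem_image.1 h2
    exact Nat.not_prime_mul (hp _).ne_one (hp _).ne_one (hPp _ h1).1
  have hQc : Q.card = Fintype.card E := by
    rw [Finset.card_image_of_injective _ hval, Finset.card_univ]
  have hPc : Nat.primeCounting n ≤ P.card + (Fintype.card L + Fintype.card R) := by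
    have := Finset.le_card_sdiff (univ.image lab) n.primesLE
    rw [Finset.card_image_of_injective _ hinj, Finset.card_univ, Fintype.card_sum,
      Nat.primesLE_card_eq_primeCounting] at this
    simp only [P]; omega
  have hmem : (P ∪ Q).card ≤ fkd (3 * T) 3 n := by
    apply le_csSup (fkd_bdd _ _ _)
    refine ⟨P ∪ Q, ?_, rfl, ?_⟩
    · intro y hy
      rw [Finset.mem_Icc]
      rcases Finset.mem_union.1 hy with hy | hy
      · exact ⟨(hPp y hy).1.one_le, (hPp y hy).2.1⟩
      · obtain ⟨e, -, rfl⟩ := Finset.mem_image.1 hy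
        refine ⟨Nat.mul_pos (hp _).pos (hp _).pos, ?_⟩
        have h1 := hle (.inl (al e))
        have h2 := hle (.inr (be e))
        simp only [val]
        nlinarith [sq_nonneg ((lab (.inl (al e)) : ℤ) - lab (.inr (be e)))]
    · intro a x ha hx hprod
      rw [trivialSol_iff]
      set cnt : ℕ → ℕ := fun y => (univ.filter fun i => a i = y).card with hcnt
      have hsum : ∀ g : ℕ → ℕ, ∑ i, g (a i) = ∑ y ∈ P, cnt y * g y + ∑ e, cnt (val e) * g (val e) := by
        intro g
        rw [← Finset.sum_fiberwise_of_maps_to (g := a) (t := P ∪ Q) (fun i _ => ha i),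
          Finset.sum_union hdisj, Finset.sum_image (fun _ _ _ _ h => hval h)]
        congr 1
        · apply Finset.sum_congr rfl
          intro y _
          rw [Finset.sum_congr rfl (g := fun _ => g y)]
          · simp [hcnt]
          · intro i hi; simp at hi; rw [hi]
        · apply Finset.sum_congr rfl
          intro e _
          rw [Finset.sum_congr rfl (g := fun _ => g (val e))]
          · simp [hcnt]
          · intro i hi; simp at hi; rw [hi]
      have h3 : ∀ p, 3 ∣ ∑ y ∈ P, cnt y * y.factorization p + ∑ e, cnt (val e) * (val e).factorization p := by
        intro p
        rw [← hsum (fun y => y.factorization p)]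
        have hne : ∀ i ∈ (univ : Finset (Fin (3*T))), a i ≠ 0 := by
          intro i _
          rcases Finset.mem_union.1 (ha i) with hy | hy
          · exact (hPp _ hy).1.ne_zero
          · obtain ⟨e, -, h⟩ := Finset.mem_image.1 hy
            rw [← h]; exact Nat.mul_ne_zero (hp _).ne_zero (hp _).ne_zero
        have := congrArg (fun m => m.factorization p) hprod
        simp only [Nat.factorization_prod hne, Nat.factorization_pow, Finsupp.coe_finset_sum,
          Finset.sum_apply, Finsupp.smul_apply, smul_eq_mul] at this
        rw [this]; exact Dvd.intro _ rfl
      have hlabP : ∀ v, ∑ y ∈ P, cnt y * y.factorization (lab v) = 0 := by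
        intro v
        apply Finset.sum_eq_zero
        intro y hy
        rw [(hPp y hy).1.factorization]
        simp [Finsupp.single_apply, ((hPp y hy).2.2 v).symm]
      have hE : ∀ e, 3 ∣ cnt (val e) := by
        refine weights_dvd al be T hno (fun e => cnt (val e)) ?_ ?_ ?_
        · intro u
          have := h3 (lab (.inl u))
          rw [hlabP, zero_add] at this
          simpa [hfac, hinj.eq_iff, Finset.sum_filter] using this
        · intro u
          have := h3 (lab (.inr u))
          rw [hlabP, zero_add] at this
          simpa [hfac, hinj.eq_iff, Finset.sum_filter] using this
        · have := hsum (fun _ => 1)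
          simp at this
          omega
      intro y
      change 3 ∣ cnt y
      by_cases hyQ : y ∈ Q
      · obtain ⟨e, -, rfl⟩ := Finset.mem_image.1 hyQ
        exact hE e
      by_cases hyP : y ∈ P
      · have h4 := h3 y
        have hz : ∑ e, cnt (val e) * (val e).factorization y = 0 := by
          apply Finset.sum_eq_zero
          intro e _
          rw [hfac]
          simp [(hPp y hyP).2.2]
        rw [hz, add_zero, Finset.sum_eq_single y] at h4
        · simpa [(hPp y hyP).1.factorization] using h4
        · intro q hq hqy
          rw [(hPp q hq).1.factorization]
          simp [Finsupp.single_apply, hqy]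
        · intro h; exact absurd hyP h
      · have : cnt y = 0 := by
          simp only [hcnt, Finset.card_eq_zero, Finset.filter_eq_empty_iff]
          intro i _ h
          have := ha i
          rw [h, Finset.mem_union] at this
          tauto
        rw [this]; exact dvd_zero _
  rw [Finset.card_union_of_disjoint hdisj] at hmem
  omega

namespace Gph
open PowerSeries

variable {F : Type*} [Field F]

/-- truncated series -/
noncomputable def ser (m : ℕ) (f : Fin m → F) : PowerSeries F :=
  PowerSeries.mk fun k => if h : k < m then f ⟨k, h⟩ else 0

theorem coeff_ser (m : ℕ) (f : Fin m → F) (k : ℕ) (h : k < m) : coeff k (ser m f) = f ⟨k, h⟩ := by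
  simp [ser, h]

/-- edges -/
abbrev Edge (F : Type*) (l B : ℕ) := (Fin l → F) × (Fin B → F) × (Fin l → F)

variable {l B : ℕ}

noncomputable def ea (e : Edge F l B) : PowerSeries F := 1 + X * ser l e.1
noncomputable def eb (e : Edge F l B) : PowerSeries F := ser B e.2.1
noncomputable def ec (e : Edge F l B) : PowerSeries F := X * ser l e.2.2
noncomputable def ed (e : Edge F l B) : PowerSeries F := (1 + eb e * ec e) * (ea e)⁻¹
noncomputable def M (e : Edge F l B) : Matrix (Fin 2) (Fin 2) (PowerSeries F) :=
  !![ea e, eb e; ec e, ed e]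

theorem ea0 (e : Edge F l B) : constantCoeff (ea e) = 1 := by simp [ea]
theorem ec0 (e : Edge F l B) : constantCoeff (ec e) = 0 := by simp [ec]
theorem ea_mul_ed (e : Edge F l B) : ea e * ed e = 1 + eb e * ec e := by
  have := PowerSeries.mul_inv_cancel (ea e) (by rw [ea0]; exact one_ne_zero)
  unfold ed
  linear_combination (1 + eb e * ec e) * this
theorem ed0 (e : Edge F l B) : constantCoeff (ed e) = 1 := by
  have := congrArg constantCoeff (ea_mul_ed e)
  simpa [ea0, ec0] using this

theorem X_dvd_ec (e : Edge F l B) : X ∣ ec e := Dvd.intro _ rfl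

/-- congruence -/
def Cong (l B : ℕ) (M M' : Matrix (Fin 2) (Fin 2) (PowerSeries F)) : Prop :=
  X ^ (l+1) ∣ M' 0 0 - M 0 0 ∧ X ^ B ∣ M' 0 1 - M 0 1 ∧ X ^ (l+1) ∣ M' 1 0 - M 1 0 ∧
    X ^ (l+1) ∣ M' 1 1 - M 1 1

theorem Cong.rfl' (M : Matrix (Fin 2) (Fin 2) (PowerSeries F)) : Cong l B M M := by
  simp [Cong]

theorem Cong.trans {M M' M'' : Matrix (Fin 2) (Fin 2) (PowerSeries F)} (h : Cong l B M M')
    (h' : Cong l B M' M'') : Cong l B M M'' := by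
  obtain ⟨h1, h2, h3, h4⟩ := h
  obtain ⟨k1, k2, k3, k4⟩ := h'
  refine ⟨?_, ?_, ?_, ?_⟩
  · simpa using dvd_add h1 k1
  · simpa using dvd_add h2 k2
  · simpa using dvd_add h3 k3
  · simpa using dvd_add h4 k4

theorem pow_dvd_mulX {b c : PowerSeries F} (hB : l ≤ B) (hb : X ^ B ∣ b) (hc : X ∣ c) :
    X ^ (l+1) ∣ b * c := by
  have := mul_dvd_mul hb hc
  rw [← pow_succ] at this
  exact (pow_dvd_pow _ (by omega)).trans this

theorem Cong.mul_right {M M' : Matrix (Fin 2) (Fin 2) (PowerSeries F)} (hB : l ≤ B) (hB' : B ≤ l + 1)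
    (h : Cong l B M M') (N : Matrix (Fin 2) (Fin 2) (PowerSeries F)) (hN : X ∣ N 1 0) :
    Cong l B (M * N) (M' * N) := by
  obtain ⟨h1, h2, h3, h4⟩ := h
  have hp : (X : PowerSeries F) ^ B ∣ X ^ (l+1) := pow_dvd_pow _ hB'
  refine ⟨?_, ?_, ?_, ?_⟩ <;> simp only [Matrix.mul_apply, Fin.sum_univ_two]
  · convert dvd_add (h1.mul_right (N 0 0)) (pow_dvd_mulX hB h2 hN) using 1; ring
  · convert dvd_add ((hp.trans h1).mul_right (N 0 1)) (h2.mul_right (N 1 1)) using 1; ring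
  · convert dvd_add (h3.mul_right (N 0 0)) (h4.mul_right (N 1 0)) using 1; ring
  · convert dvd_add (h3.mul_right (N 0 1)) (h4.mul_right (N 1 1)) using 1; ring

theorem Cong.mul_left {M M' : Matrix (Fin 2) (Fin 2) (PowerSeries F)} (hB : l ≤ B) (hB' : B ≤ l + 1)
    (h : Cong l B M M') (N : Matrix (Fin 2) (Fin 2) (PowerSeries F)) (hN : X ∣ N 1 0) :
    Cong l B (N * M) (N * M') := by
  obtain ⟨h1, h2, h3, h4⟩ := h
  have hp : (X : PowerSeries F) ^ B ∣ X ^ (l+1) := pow_dvd_pow _ hB'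
  refine ⟨?_, ?_, ?_, ?_⟩ <;> simp only [Matrix.mul_apply, Fin.sum_univ_two]
  · convert dvd_add (h1.mul_left (N 0 0)) (h3.mul_left (N 0 1)) using 1; ring
  · convert dvd_add (h2.mul_left (N 0 0)) ((hp.trans h4).mul_left (N 0 1)) using 1; ring
  · convert dvd_add (h1.mul_left (N 1 0)) (h3.mul_left (N 1 1)) using 1; ring
  · convert dvd_add (pow_dvd_mulX hB h2 hN) (h4.mul_left (N 1 1)) using 1; ring

noncomputable def lv (e : Edge F l B) : (Fin l → F) × (Fin l → F) × (Fin (B-1) → F) :=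
  (e.1, e.2.2, fun i => coeff (i+1) (eb e - C (coeff 0 (eb e)) * ea e))

noncomputable def rv (e : Edge F l B) : (Fin B → F) × (Fin l → F) × (Fin (l-1) → F) :=
  (e.2.1, fun i => coeff (i+1) (ed e),
    fun i => coeff (i+2) (ec e - C (coeff 1 (ec e)) * (X * ed e)))

noncomputable def Um (s : F) : Matrix (Fin 2) (Fin 2) (PowerSeries F) := !![1, C s; 0, 1]
noncomputable def Lm (s : F) : Matrix (Fin 2) (Fin 2) (PowerSeries F) := !![1, 0; C s * X, 1]

theorem dvd_of_mul_unit {a b : PowerSeries F} {n : ℕ} (ha : constantCoeff a = 1) (h : X ^ n ∣ a * b) :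
    X ^ n ∣ b := by
  have hu : IsUnit a := by rw [isUnit_iff_constantCoeff, ha]; exact isUnit_one
  exact (hu.dvd_mul_left).1 h

theorem step_left (hB : l ≤ B) (e e' : Edge F l B) (hv : lv e' = lv e) (hne : e ≠ e') :
    ∃ s : F, s ≠ 0 ∧ Cong l B (M e * Um s) (M e') := by
  obtain ⟨f, g, h⟩ := e
  obtain ⟨f', g', h'⟩ := e'
  simp only [lv, Prod.mk.injEq] at hv
  obtain ⟨rfl, rfl, h3⟩ := hv
  set e : Edge F l B := (f', g, h') with he
  set e' : Edge F l B := (f', g', h') with he'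
  have haa : ea e' = ea e := rfl
  have hcc : ec e' = ec e := rfl
  set s := coeff 0 (eb e') - coeff 0 (eb e) with hs
  have key : X ^ B ∣ eb e' - eb e - C s * ea e := by
    rw [X_pow_dvd_iff]
    intro m hm
    rcases m with _ | m
    · simp [ea0, hs]
    · have := congrFun h3 ⟨m, by omega⟩
      simp only [haa, map_sub, coeff_C_mul] at this
      simp only [map_sub, coeff_C_mul]
      rw [hs]
      linear_combination this
  refine ⟨s, ?_, ?_⟩
  · intro h0
    apply hne
    rw [h0] at key
    have : g = g' := by
      funext i
      have := (X_pow_dvd_iff.1 key) i i.2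
      simp only [map_zero, zero_mul, sub_zero, map_sub, eb, coeff_ser _ _ _ i.2, he, he'] at this
      exact (sub_eq_zero.1 this).symm
    rw [he, he', this]
  · refine ⟨?_, ?_, ?_, ?_⟩ <;> simp only [M, Um, Matrix.mul_apply, Fin.sum_univ_two,
      Matrix.of_apply, Matrix.cons_val', Matrix.cons_val_zero, Matrix.cons_val_one, Matrix.cons_val_fin_one]
    · simp [haa]
    · convert key using 1; ring
    · simp [hcc]
    · apply dvd_of_mul_unit (ea0 e)
      convert pow_dvd_mulX hB key (X_dvd_ec e) using 1
      have h1 := ea_mul_ed e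
      have h2 := ea_mul_ed e'
      rw [haa, hcc] at h2
      linear_combination h2 - h1

theorem step_right (hB : l ≤ B) (e e' : Edge F l B) (hv : rv e' = rv e) (hne : e ≠ e') :
    ∃ s : F, s ≠ 0 ∧ Cong l B (M e * Lm s) (M e') := by
  obtain ⟨f, g, h⟩ := e
  obtain ⟨f', g', h'⟩ := e'
  simp only [rv, Prod.mk.injEq] at hv
  obtain ⟨rfl, h2, h3⟩ := hv
  set e : Edge F l B := (f, g', h) with he
  set e' : Edge F l B := (f', g', h') with he'
  have hbb : eb e' = eb e := rfl
  set s := coeff 1 (ec e') - coeff 1 (ec e) with hs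
  have keyd : X ^ (l+1) ∣ ed e' - ed e := by
    rw [X_pow_dvd_iff]
    intro m hm
    rcases m with _ | m
    · simp [ed0]
    · have := congrFun h2 ⟨m, by omega⟩
      simp only at this
      rw [map_sub, this, sub_self]
  have keyc : X ^ (l+1) ∣ ec e' - ec e - C s * (X * ed e) := by
    rw [X_pow_dvd_iff]
    intro m hm
    rcases m with _ | _ | m
    · simp [ec0]
    · simp only [zero_add, map_sub, coeff_C_mul, coeff_succ_X_mul]
      rw [coeff_zero_eq_constantCoeff, ed0, hs]; ring
    · have := congrFun h3 ⟨m, by omega⟩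
      have h4 := congrFun h2 ⟨m, by omega⟩
      simp only at h4
      simp only [map_sub, coeff_C_mul, coeff_succ_X_mul, h4] at this
      simp only [map_sub, coeff_C_mul, coeff_succ_X_mul]
      rw [hs]
      linear_combination this
  have h1 := ea_mul_ed e
  have h2 := ea_mul_ed e'
  rw [hbb] at h2
  have keya : X ^ (l+1) ∣ ea e' - (ea e + eb e * (C s * X)) := by
    apply dvd_of_mul_unit (ed0 e)
    convert dvd_sub (keyc.mul_left (eb e)) (keyd.mul_right (ea e')) using 1
    linear_combination h2 - h1
  refine ⟨s, ?_, ?_⟩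
  · intro h0
    apply hne
    rw [h0] at keya keyc
    have e1 : f = f' := by
      funext i
      have := (X_pow_dvd_iff.1 keya) (i+1) (by omega)
      simp only [map_zero, zero_mul, mul_zero, add_zero, map_sub, ea, map_add, coeff_succ_X_mul,
        coeff_ser _ _ _ i.2, he, he'] at this
      simp at this
      exact (sub_eq_zero.1 this).symm
    have e2 : h = h' := by
      funext i
      have := (X_pow_dvd_iff.1 keyc) (i+1) (by omega)
      simp only [map_zero, zero_mul, mul_zero, sub_zero, map_sub, ec, map_add, coeff_succ_X_mul,
        coeff_ser _ _ _ i.2, he, he'] at this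
      exact (sub_eq_zero.1 this).symm
    rw [he, he', e1, e2]
  · refine ⟨?_, ?_, ?_, ?_⟩ <;> simp only [M, Lm, Matrix.mul_apply, Fin.sum_univ_two,
      Matrix.of_apply, Matrix.cons_val', Matrix.cons_val_zero, Matrix.cons_val_one, Matrix.cons_val_fin_one]
    · convert keya using 1; ring
    · simp [hbb]
    · convert keyc using 1; ring
    · convert keyd using 1; ring

/-- degree invariant for words -/
def Inv (t : ℕ) (W : Matrix (Fin 2) (Fin 2) (PowerSeries F)) : Prop :=
  (∀ k, t < k → coeff k (W 0 0) = 0) ∧ coeff t (W 0 0) ≠ 0 ∧ (∀ k, t ≤ k → coeff k (W 0 1) = 0) ∧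
  (∀ k, t < k → coeff k (W 1 0) = 0) ∧ (∀ k, t ≤ k → 1 ≤ k → coeff k (W 1 1) = 0) ∧
  X ∣ W 1 0 ∧ W.det = 1

theorem Inv.step {t : ℕ} {W : Matrix (Fin 2) (Fin 2) (PowerSeries F)} (h : Inv t W) (r s : F)
    (hr : r ≠ 0) (hs : s ≠ 0) : Inv (t+1) (W * (Um r * Lm s)) := by
  obtain ⟨h1, h2, h3, h4, h5, h6, h7⟩ := h
  have e00 : (W * (Um r * Lm s)) 0 0 = W 0 0 + C (r * s) * (X * W 0 0) + C s * (X * W 0 1) := by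
    simp [Matrix.mul_apply, Um, Lm]; ring
  have e01 : (W * (Um r * Lm s)) 0 1 = C r * W 0 0 + W 0 1 := by
    simp [Matrix.mul_apply, Um, Lm]; ring
  have e10 : (W * (Um r * Lm s)) 1 0 = W 1 0 + C (r * s) * (X * W 1 0) + C s * (X * W 1 1) := by
    simp [Matrix.mul_apply, Um, Lm]; ring
  have e11 : (W * (Um r * Lm s)) 1 1 = C r * W 1 0 + W 1 1 := by
    simp [Matrix.mul_apply, Um, Lm]; ring
  unfold Inv
  rw [e00, e01, e10, e11]
  refine ⟨?_, ?_, ?_, ?_, ?_, ?_, ?_⟩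
  · rintro (_ | k) hk
    · omega
    · simp only [map_add, coeff_C_mul, coeff_succ_X_mul]
      rw [h1 _ (by omega), h1 _ (by omega), h3 _ (by omega)]; ring
  · simp only [map_add, coeff_C_mul, coeff_succ_X_mul]
    rw [h1 _ (by omega), h3 _ (by omega)]
    simp [hr, hs, h2]
  · intro k hk
    simp only [map_add, coeff_C_mul]
    rw [h1 _ (by omega), h3 _ (by omega)]; ring
  · rintro (_ | k) hk
    · omega
    · simp only [map_add, coeff_C_mul, coeff_succ_X_mul]
      rw [h4 _ (by omega), h4 _ (by omega), h5 _ (by omega) (by omega)]; ring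
  · intro k hk _
    simp only [map_add, coeff_C_mul]
    rw [h4 _ (by omega), h5 _ (by omega) (by omega)]; ring
  · refine dvd_add (dvd_add h6 ?_) ?_
    · exact (Dvd.intro _ rfl : X ∣ X * W 1 0).mul_left _
    · exact (Dvd.intro _ rfl : X ∣ X * W 1 1).mul_left _
  · rw [Matrix.det_mul, Matrix.det_mul, h7]
    simp [Um, Lm, Matrix.det_fin_two]

theorem no_closed (hB : l ≤ B) (hB' : B ≤ l + 1) (t : ℕ) (ht : 1 ≤ t) (ht' : t ≤ l + B)
    (z z' : ℕ → Edge F l B) (h1 : ∀ k < t, z k ≠ z' k ∧ lv (z' k) = lv (z k))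
    (h2 : ∀ k < t, z' k ≠ z (k+1) ∧ rv (z (k+1)) = rv (z' k)) (h0 : z t = z 0) : False := by
  have path : ∀ k ≤ t, ∃ W, Inv k W ∧ Cong l B (M (z 0) * W) (M (z k)) := by
    intro k hk
    induction k with
    | zero =>
      refine ⟨1, ⟨?_, ?_, ?_, ?_, ?_, ?_, ?_⟩, ?_⟩
      · intro k hk; simp [coeff_one]; omega
      · simp
      · simp
      · simp
      · intro k _ hk; simp [coeff_one]; omega
      · simp
      · simp
      · rw [mul_one]; exact Cong.rfl' _
    | succ k ih =>
      obtain ⟨W, hW, hc⟩ := ih (by omega)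
      obtain ⟨r, hr, hcr⟩ := step_left hB _ _ (h1 k (by omega)).2 (h1 k (by omega)).1
      obtain ⟨s, hs, hcs⟩ := step_right hB _ _ (h2 k (by omega)).2 (h2 k (by omega)).1
      refine ⟨W * (Um r * Lm s), hW.step r s hr hs, ?_⟩
      refine Cong.trans ?_ hcs
      rw [← mul_assoc, ← mul_assoc]
      refine Cong.mul_right hB hB' ?_ _ (by simp [Lm])
      refine Cong.trans ?_ hcr
      exact Cong.mul_right hB hB' hc _ (by simp [Um])
  obtain ⟨W, ⟨i1, i2, i3, i4, i5, i6, i7⟩, hc⟩ := path t le_rfl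
  rw [h0] at hc
  have hdet : (M (z 0)).det = 1 := by
    rw [M, Matrix.det_fin_two_of]
    linear_combination ea_mul_ed (z 0)
  have hc2 := Cong.mul_left hB hB' hc (M (z 0)).adjugate (by
    simp [Matrix.adjugate_fin_two, M]; exact X_dvd_ec _)
  rw [← mul_assoc, Matrix.adjugate_mul, hdet, one_smul, one_mul] at hc2
  obtain ⟨c1, c2, c3, c4⟩ := hc2
  simp only [Matrix.one_apply] at c1 c2 c3 c4
  simp at c2 c3
  simp only [if_true] at c1 c4
  rw [Matrix.det_fin_two] at i7
  have hd1 : X ^ (l + 1 + B) ∣ W 0 1 * W 1 0 := by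
    rw [mul_comm, pow_add]; exact mul_dvd_mul c3 c2
  have hd2 : X ^ (l + 1 + B) ∣ (1 - W 0 0) * (1 - W 1 1) := by
    refine (pow_dvd_pow _ ?_).trans ((pow_add (X : PowerSeries F) (l+1) (l+1)).symm ▸ mul_dvd_mul c1 c4)
    omega
  have hd : X ^ (l + 1 + B) ∣ W 0 0 + W 1 1 - 2 := by
    convert dvd_sub hd1 hd2 using 1
    linear_combination i7
  have := X_pow_dvd_iff.1 hd t (by omega)
  rw [map_sub, map_add, i5 t le_rfl ht] at this
  have h2 : coeff t (2 : PowerSeries F) = 0 := by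
    have : (2 : PowerSeries F) = C 2 := (map_ofNat (C (R := F)) 2).symm
    rw [this, coeff_C]; rw [if_neg (by omega)]
  rw [h2] at this
  simp at this
  exact i2 this

end Gph

theorem lower_count (q : ℕ) (hq : q.Prime) (l B n : ℕ) (hl : 1 ≤ l) (hB : l ≤ B) (hB' : B ≤ l + 1)
    (hn : 2 * q ^ (2 * l + B - 1) ≤ Nat.primeCounting (Nat.sqrt n)) :
    Nat.primeCounting n + q ^ (2 * l + B - 1 + 1) ≤ fkd (3 * (l + B)) 3 n + 2 * q ^ (2 * l + B - 1) := by
  classical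
  haveI : Fact q.Prime := ⟨hq⟩
  let L := (Fin l → ZMod q) × (Fin l → ZMod q) × (Fin (B-1) → ZMod q)
  let R := (Fin B → ZMod q) × (Fin l → ZMod q) × (Fin (l-1) → ZMod q)
  have hL : Fintype.card L = q ^ (2 * l + B - 1) := by
    simp [L, ZMod.card, ← pow_add]; congr 1; omega
  have hR : Fintype.card R = q ^ (2 * l + B - 1) := by
    simp [R, ZMod.card, ← pow_add]; congr 1; omega
  have hE : Fintype.card (Gph.Edge (ZMod q) l B) = q ^ (2 * l + B - 1 + 1) := by
    simp [Gph.Edge, ZMod.card, ← pow_add]; congr 1; omega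
  have hemb : Nonempty (L ⊕ R ↪ (Nat.sqrt n).primesLE) := by
    apply Function.Embedding.nonempty_of_card_le
    rw [Fintype.card_sum, hL, hR, Fintype.card_coe, Nat.primesLE_card_eq_primeCounting]
    omega
  obtain ⟨φ⟩ := hemb
  have hno : NoClosed (Gph.lv : Gph.Edge (ZMod q) l B → L) (Gph.rv : Gph.Edge (ZMod q) l B → R) (l + B) := by
    intro t z z' h1 h2 h3 h4 h5
    exact Gph.no_closed hB hB' t h1 h2 z z' h3 h4 h5
  have hφ : ∀ v, (φ v : ℕ) ≤ Nat.sqrt n ∧ (φ v : ℕ).Prime := fun v => by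
    have := (φ v).2
    rwa [Nat.mem_primesLE] at this
  have := graph_to_set _ _ (l + B) n (by omega) hno (fun v => (φ v : ℕ))
    (fun v w h => φ.injective (Subtype.ext h)) (fun v => (hφ v).2)
    (fun v => (Nat.pow_le_pow_left (hφ v).1 2).trans (Nat.sqrt_le' n))
  rw [hL, hR, hE] at this
  omega

theorem cheb_lower : ∀ᶠ n : ℕ in atTop,
    (n : ℝ) ^ ((1:ℝ)/2) / Real.log n / 8 ≤ (Nat.primeCounting (Nat.sqrt n) : ℝ) := by
  filter_upwards [eventually_ge_atTop 100] with n hn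
  have hs : 10 ≤ Nat.sqrt n := by rw [Nat.le_sqrt']; omega
  set s := Nat.sqrt n with hsdef
  have hsn : (n : ℝ) ^ ((1:ℝ)/2) ≤ s + 1 := by
    rw [← Real.sqrt_eq_rpow, Real.sqrt_le_left (by positivity)]
    exact_mod_cast (Nat.lt_succ_sqrt' n).le
  have hs' : (10 : ℝ) ≤ s := by exact_mod_cast hs
  have h1 := (Chebyshev.psi_ge s).trans (Chebyshev.psi_le_primeCounting_mul_log s)
  have hlog : Real.log (s + 1) ≤ (s + 1) / 8 - 1 + 3 * Real.log 2 := by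
    have := Real.log_le_sub_one_of_pos (x := ((s:ℝ) + 1) / 8) (by positivity)
    rw [Real.log_div (by positivity) (by norm_num)] at this
    have h8 : Real.log 8 = 3 * Real.log 2 := by
      rw [show (8:ℝ) = 2 ^ 3 by norm_num, Real.log_pow]; norm_num
    linarith
  have hle : Real.log s ≤ Real.log n := by
    apply Real.log_le_log (by positivity)
    exact_mod_cast Nat.sqrt_le_self n
  have hn1 : 0 < Real.log n := Real.log_pos (by exact_mod_cast (by omega : 1 < n))
  have h2 : (Nat.primeCounting s : ℝ) * Real.log s ≤ Nat.primeCounting s * Real.log n := by gcongr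
  rw [div_div, div_le_iff₀ (by positivity)]
  have l1 := Real.log_two_gt_d9
  have l2 := Real.log_two_lt_d9
  nlinarith

theorem lower_asymp (V : ℕ) (hV : 1 ≤ V) (f : ℕ → ℕ)
    (H : ∀ q n : ℕ, q.Prime → 2 * q ^ V ≤ Nat.primeCounting (Nat.sqrt n) →
      Nat.primeCounting n + q ^ (V + 1) ≤ f n + 2 * q ^ V) :
    ∃ c : ℝ, 0 < c ∧ ∀ᶠ n : ℕ in atTop, (Nat.primeCounting n : ℝ) +
      c * (n : ℝ) ^ (((V : ℝ) + 1) / (2 * V)) / (Real.log n) ^ (((V : ℝ) + 1) / V) ≤ f n := by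
  have hV0 : (0 : ℝ) < V := by exact_mod_cast hV
  refine ⟨(1 / 2) ^ (V + 2) * (1 / 16 : ℝ) ^ (((V : ℝ) + 1) / V), by positivity, ?_⟩
  have hlog : ∀ᶠ n : ℕ in atTop, (16 * 8 ^ V) * Real.log n ≤ (n : ℝ) ^ ((1:ℝ)/2) := by
    have h := (isLittleO_log_rpow_atTop (r := (1:ℝ)/2) (by norm_num)).bound
      (c := 1 / (16 * 8 ^ V)) (by positivity)
    have h' := tendsto_natCast_atTop_atTop (R := ℝ) |>.eventually h
    filter_upwards [h'] with n hn
    have h2 : Real.log n ≤ 1 / (16 * 8 ^ V) * (n : ℝ) ^ ((1:ℝ)/2) := by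
      refine (le_abs_self _).trans (hn.trans (le_of_eq ?_))
      rw [Real.norm_of_nonneg (by positivity)]
    rw [div_mul_eq_mul_div, one_mul, le_div_iff₀ (by positivity)] at h2
    linarith
  filter_upwards [cheb_lower, hlog, eventually_ge_atTop 3] with n hch hZ hn3
  have hn1 : 0 < Real.log n := Real.log_pos (by exact_mod_cast (by omega : 1 < n))
  set Z : ℝ := (n : ℝ) ^ ((1:ℝ)/2) / Real.log n with hZdef
  have hZ' : 16 * 8 ^ V ≤ Z := by rw [hZdef, le_div_iff₀ hn1]; exact hZ
  have hZ0 : 0 ≤ Z := by positivity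
  set x : ℝ := (Z / 16) ^ ((1:ℝ) / V) with hx
  have hxV : x ^ V = Z / 16 := by
    rw [hx, ← Real.rpow_natCast, ← Real.rpow_mul (by positivity), one_div, inv_mul_cancel₀ hV0.ne', Real.rpow_one]
  have hx0 : 0 ≤ x := by positivity
  have hx8 : 8 ≤ x := by
    apply le_of_pow_le_pow_left₀ (n := V) (by omega) hx0
    rw [hxV]; linarith
  obtain ⟨q, hq, hq1, hq2⟩ := Nat.exists_prime_lt_and_le_two_mul ⌊x/2⌋₊ (by
    have : 1 ≤ ⌊x/2⌋₊ := Nat.le_floor (by push_cast; linarith)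
    omega)
  have hqx : (q : ℝ) ≤ x := by
    have h1 : (⌊x/2⌋₊ : ℝ) ≤ x / 2 := Nat.floor_le (by positivity)
    have h2 : (q : ℝ) ≤ 2 * ⌊x/2⌋₊ := by exact_mod_cast hq2
    linarith
  have hqx' : x / 2 ≤ q := by
    have h1 := Nat.lt_floor_add_one (x / 2)
    have h2 : (⌊x/2⌋₊ : ℝ) + 1 ≤ q := by exact_mod_cast hq1
    linarith
  have hcond : 2 * q ^ V ≤ Nat.primeCounting (Nat.sqrt n) := by
    have : (2 : ℝ) * (q : ℝ) ^ V ≤ Nat.primeCounting (Nat.sqrt n) := by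
      have h1 : (q : ℝ) ^ V ≤ x ^ V := by gcongr
      rw [hxV] at h1
      linarith
    exact_mod_cast this
  have hmain : (Nat.primeCounting n : ℝ) + (q : ℝ) ^ (V + 1) ≤ f n + 2 * (q : ℝ) ^ V := by
    exact_mod_cast H q n hq hcond
  have hq4 : (4 : ℝ) ≤ q := by linarith
  have h5 : (q : ℝ) ^ (V + 1) / 2 ≤ (q : ℝ) ^ (V + 1) - 2 * (q : ℝ) ^ V := by
    rw [pow_succ]
    have : 0 ≤ (q : ℝ) ^ V := by positivity
    nlinarith
  have h6 : (x / 2) ^ (V + 1) ≤ (q : ℝ) ^ (V + 1) := by gcongr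
  have h7 : x ^ (V + 1) = (1 / 16 : ℝ) ^ (((V : ℝ) + 1) / V) *
      ((n : ℝ) ^ (((V : ℝ) + 1) / (2 * V)) / (Real.log n) ^ (((V : ℝ) + 1) / V)) := by
    rw [hx, ← Real.rpow_natCast, ← Real.rpow_mul (by positivity), div_eq_mul_one_div Z,
      Real.mul_rpow hZ0 (by norm_num), hZdef, Real.div_rpow (by positivity) hn1.le,
      ← Real.rpow_mul (by positivity)]
    have e1 : (1:ℝ) / V * ((V + 1 : ℕ) : ℝ) = ((V : ℝ) + 1) / V := by push_cast; ring
    have e2 : (1:ℝ)/2 * (((V : ℝ) + 1) / V) = ((V : ℝ) + 1) / (2 * V) := by field_simp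
    rw [e1, e2]; ring
  have h8 : (1 / 2) ^ (V + 2) * (1 / 16 : ℝ) ^ (((V : ℝ) + 1) / V) *
      (n : ℝ) ^ (((V : ℝ) + 1) / (2 * V)) / (Real.log n) ^ (((V : ℝ) + 1) / V) = (x / 2) ^ (V + 1) / 2 := by
    have h9 : ((1:ℝ) / 2) ^ (V + 2) = 1 / 2 ^ (V + 1) / 2 := by
      rw [one_div_pow, pow_succ (2:ℝ) (V+1)]; field_simp
    rw [div_pow x 2, h7, h9]; ring
  rw [h8]
  linarith

theorem valid_multiset {k : ℕ} {A : Finset ℕ} (hA : ∀ (a : Fin k → ℕ) (x : ℕ), (∀ i, a i ∈ A) → 0 < x →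
      (∏ i, a i) = x ^ 3 → TrivialSol 3 a) (s : Multiset ℕ) (hk : s.card = k) (hs : ∀ y ∈ s, y ∈ A)
    (x : ℕ) (hx : 0 < x) (hp : s.prod = x ^ 3) (y : ℕ) : 3 ∣ s.count y := by
  induction s using Quotient.inductionOn with
  | h L =>
  have hk' : L.length = k := by simpa using hk
  subst hk'
  have h := hA L.get x (fun i => hs _ (by simp)) hx (by
    rw [← List.prod_ofFn, List.ofFn_get]; simpa using hp) y
  rw [List.ofFn_get] at h
  exact h

def C4free (E : Finset (ℕ × ℕ)) : Prop := ∀ u1 u2 v1 v2 : ℕ, u1 ≠ u2 → v1 ≠ v2 →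
  (u1, v1) ∈ E → (u1, v2) ∈ E → (u2, v1) ∈ E → (u2, v2) ∈ E → False

def C6free (E : Finset (ℕ × ℕ)) : Prop := ∀ u1 u2 u3 v1 v2 v3 : ℕ, u1 ≠ u2 → u1 ≠ u3 → u2 ≠ u3 →
  v1 ≠ v2 → v1 ≠ v3 → v2 ≠ v3 →
  (u1, v1) ∈ E → (u2, v1) ∈ E → (u2, v2) ∈ E → (u3, v2) ∈ E → (u3, v3) ∈ E → (u1, v3) ∈ E → False

theorem c4free_of_valid {j : ℕ} {A : Finset ℕ} (hA : ∀ (a : Fin (3 * j + 9) → ℕ) (x : ℕ), (∀ i, a i ∈ A) →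
      0 < x → (∏ i, a i) = x ^ 3 → TrivialSol 3 a) (E : Finset (ℕ × ℕ)) (hE : ∀ e ∈ E, e.1 * e.2 ∈ A)
    (hpos : ∀ e ∈ E, 0 < e.1 ∧ 0 < e.2)
    (hinj : ∀ e ∈ E, ∀ e' ∈ E, e.1 * e.2 = e'.1 * e'.2 → e = e') : C4free E := by
  intro u1 u2 v1 v2 hu hv h11 h12 h21 h22
  have p1 := hpos _ h11
  have p2 := hpos _ h22
  simp only at p1 p2
  have n1 : u1 * v1 ≠ u1 * v2 := fun h => hv (Prod.ext_iff.1 (hinj _ h11 _ h12 h)).2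
  have n2 : u2 * v2 ≠ u1 * v2 := fun h => hu (Prod.ext_iff.1 (hinj _ h22 _ h12 h)).1.symm
  have n3 : u2 * v1 ≠ u1 * v2 := fun h => hu (Prod.ext_iff.1 (hinj _ h21 _ h12 h)).1.symm
  have key := valid_multiset hA
    (Multiset.replicate (3 * j + 4) (u1 * v1) + Multiset.replicate 1 (u2 * v2) +
      Multiset.replicate 2 (u1 * v2) + Multiset.replicate 2 (u2 * v1)) (by simp; try omega)
    (by
      intro y hy
      simp only [Multiset.mem_add, Multiset.mem_replicate] at hy
      rcases hy with ((hy | hy) | hy) | hy <;> rw [hy.2]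
      · exact hE _ h11
      · exact hE _ h22
      · exact hE _ h12
      · exact hE _ h21)
    ((u1 * v1) ^ (j + 1) * (u1 * u2 * v1 * v2)) (by
      obtain ⟨a, b⟩ := p1
      obtain ⟨c, d⟩ := p2
      positivity)
    (by simp only [Multiset.prod_add, Multiset.prod_replicate]; ring) (u1 * v2)
  simp only [Multiset.count_add, Multiset.count_replicate, if_neg n1, if_neg n2, if_neg n3] at key
  simp at key

theorem c6free_of_valid {j : ℕ} {A : Finset ℕ} (hA : ∀ (a : Fin (3 * j + 9) → ℕ) (x : ℕ), (∀ i, a i ∈ A) →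
      0 < x → (∏ i, a i) = x ^ 3 → TrivialSol 3 a) (E : Finset (ℕ × ℕ)) (hE : ∀ e ∈ E, e.1 * e.2 ∈ A)
    (hpos : ∀ e ∈ E, 0 < e.1 ∧ 0 < e.2)
    (hinj : ∀ e ∈ E, ∀ e' ∈ E, e.1 * e.2 = e'.1 * e'.2 → e = e') : C6free E := by
  intro u1 u2 u3 v1 v2 v3 hu12 hu13 hu23 hv12 hv13 hv23 h11 h21 h22 h32 h33 h13
  have p1 := hpos _ h11
  have p2 := hpos _ h22
  have p3 := hpos _ h33
  simp only at p1 p2 p3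
  have n1 : u1 * v1 ≠ u2 * v1 := fun h => hu12 (Prod.ext_iff.1 (hinj _ h11 _ h21 h)).1
  have n2 : u2 * v2 ≠ u2 * v1 := fun h => hv12 (Prod.ext_iff.1 (hinj _ h22 _ h21 h)).2.symm
  have n3 : u3 * v3 ≠ u2 * v1 := fun h => hu23 (Prod.ext_iff.1 (hinj _ h33 _ h21 h)).1.symm
  have n4 : u3 * v2 ≠ u2 * v1 := fun h => hu23 (Prod.ext_iff.1 (hinj _ h32 _ h21 h)).1.symm
  have n5 : u1 * v3 ≠ u2 * v1 := fun h => hu12 (Prod.ext_iff.1 (hinj _ h13 _ h21 h)).1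
  have key := valid_multiset hA
    (Multiset.replicate (3 * j + 1) (u1 * v1) + Multiset.replicate 1 (u2 * v2) +
      Multiset.replicate 1 (u3 * v3) +
      Multiset.replicate 2 (u2 * v1) + Multiset.replicate 2 (u3 * v2) + Multiset.replicate 2 (u1 * v3))
    (by simp; try omega)
    (by
      intro y hy
      simp only [Multiset.mem_add, Multiset.mem_replicate] at hy
      rcases hy with ((((hy | hy) | hy) | hy) | hy) | hy <;> rw [hy.2]
      · exact hE _ h11
      · exact hE _ h22
      · exact hE _ h33
      · exact hE _ h21
      · exact hE _ h32
      · exact hE _ h13)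
    ((u1 * v1) ^ j * (u1 * u2 * u3 * v1 * v2 * v3)) (by
      obtain ⟨a, b⟩ := p1
      obtain ⟨c, d⟩ := p2
      obtain ⟨c', d'⟩ := p3
      positivity)
    (by simp only [Multiset.prod_add, Multiset.prod_replicate]; ring) (u2 * v1)
  simp only [Multiset.count_add, Multiset.count_replicate, if_neg n1, if_neg n2, if_neg n3, if_neg n4,
    if_neg n5] at key
  simp at key

theorem bad_edges {X : Type*} (E : Finset X) (f : X → ℕ) (A : Finset ℕ) (hf : ∀ e ∈ E, f e ∈ A) :
    4 * (E.filter fun e => 4 * A.card * (E.filter fun e' => f e' = f e).card < E.card).card ≤ E.card := by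
  classical
  rcases E.eq_empty_or_nonempty with rfl | ⟨e0, he0⟩
  · simp
  have hA : 0 < A.card := Finset.card_pos.2 ⟨_, hf _ he0⟩
  set D := E.filter fun e => 4 * A.card * (E.filter fun e' => f e' = f e).card < E.card with hD
  have h1 : D.card = ∑ u ∈ A, (D.filter fun e => f e = u).card :=
    Finset.card_eq_sum_card_fiberwise (fun e he => hf _ (Finset.mem_filter.1 he).1)
  have h2 : ∀ u ∈ A, 4 * A.card * (D.filter fun e => f e = u).card ≤ E.card := by
    intro u _
    rcases (D.filter fun e => f e = u).eq_empty_or_nonempty with h | ⟨e, he⟩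
    · rw [h]; simp
    · rw [Finset.mem_filter] at he
      obtain ⟨he, rfl⟩ := he
      refine le_trans ?_ (Finset.mem_filter.1 he).2.le
      gcongr
      exact Finset.filter_subset _ _
  have h3 : 4 * A.card * D.card ≤ A.card * E.card := by
    rw [h1, Finset.mul_sum]
    refine (Finset.sum_le_sum h2).trans ?_
    simp
  have : A.card * (4 * D.card) ≤ A.card * E.card := by linarith
  exact Nat.le_of_mul_le_mul_left this hA

theorem girth8_bound (E : Finset (ℕ × ℕ)) (A B : Finset ℕ) (hE : ∀ e ∈ E, e.1 ∈ A ∧ e.2 ∈ B)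
    (h4 : C4free E) (h6 : C6free E) (ha : 8 * A.card ≤ E.card) (hb : 8 * B.card ≤ E.card) :
    E.card ^ 3 ≤ 128 * (A.card * B.card) ^ 2 := by
  classical
  let d1 : ℕ × ℕ → Finset (ℕ × ℕ) := fun e => E.filter fun e' => e'.1 = e.1
  let d2 : ℕ × ℕ → Finset (ℕ × ℕ) := fun e => E.filter fun e' => e'.2 = e.2
  have hpaths : ∑ e ∈ E, ((d1 e).card - 1) * ((d2 e).card - 1) ≤ A.card * B.card := by
    have hs : (E.sigma fun e => (d1 e).erase e ×ˢ (d2 e).erase e).card =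
        ∑ e ∈ E, ((d1 e).card - 1) * ((d2 e).card - 1) := by
      rw [Finset.card_sigma]
      apply Finset.sum_congr rfl
      intro e he
      rw [Finset.card_product, Finset.card_erase_of_mem (by simp [d1, he]),
        Finset.card_erase_of_mem (by simp [d2, he])]
    rw [← hs, ← Finset.card_product]
    apply Finset.card_le_card_of_injOn (fun p => (p.2.2.1, p.2.1.2))
    · rintro ⟨e, e1, e2⟩ h
      simp [d1, d2] at h
      simp
      exact ⟨(hE _ h.2.2.1.1).1, (hE _ h.2.1.1.1).2⟩
    · rintro ⟨⟨u, v⟩, ⟨u1, v1⟩, ⟨u2, v2⟩⟩ h ⟨⟨u', v'⟩, ⟨u1', v1'⟩, ⟨u2', v2'⟩⟩ h' heq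
      simp [d1, d2] at h h' heq
      obtain ⟨rfl, rfl⟩ := heq
      obtain ⟨ha1, ⟨⟨ha3, rfl⟩, ha2⟩, ⟨ha5, rfl⟩, ha4⟩ := h
      obtain ⟨hb1, ⟨⟨hb3, rfl⟩, hb2⟩, ⟨hb5, rfl⟩, hb4⟩ := h'
      have q1 : v1 ≠ v2 := ha2 rfl
      have q2 : u2 ≠ u1 := fun h => ha4 h rfl
      have q3 : v1 ≠ v2' := hb2 rfl
      have q4 : u2 ≠ u1' := fun h => hb4 h rfl
      by_cases hu : u1 = u1'
      · subst hu
        by_cases hv : v2 = v2'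
        · subst hv; rfl
        · exact (h4 u1 u2 v2 v2' q2.symm hv ha1 hb1 ha5 hb5).elim
      · by_cases hv : v2 = v2'
        · subst hv
          exact (h4 u1 u1' v1 v2 hu q1 ha3 ha1 hb3 hb1).elim
        · exact (h6 u1 u1' u2 v1 v2' v2 hu q2.symm q4.symm q3 q1 (Ne.symm hv) ha3 hb3 hb1 hb5 ha5 ha1).elim
  set a := A.card
  set b := B.card
  set N := E.card with hN
  let B1 := E.filter fun e => 4 * a * (d1 e).card < N
  let B2 := E.filter fun e => 4 * b * (d2 e).card < N
  have hB1 : 4 * B1.card ≤ N := bad_edges E Prod.fst A (fun e he => (hE e he).1)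
  have hB2 : 4 * B2.card ≤ N := bad_edges E Prod.snd B (fun e he => (hE e he).2)
  let G := E.filter fun e => N ≤ 4 * a * (d1 e).card ∧ N ≤ 4 * b * (d2 e).card
  have hG : N ≤ 2 * G.card := by
    have : E ⊆ G ∪ (B1 ∪ B2) := by
      intro e he
      simp only [G, B1, B2, Finset.mem_union, Finset.mem_filter, he, true_and]
      omega
    have h1 := Finset.card_le_card this
    have h2 := Finset.card_union_le G (B1 ∪ B2)
    have h3 := Finset.card_union_le B1 B2
    omega
  have hlow : ∀ e ∈ G, N * N ≤ 64 * (a * b) * (((d1 e).card - 1) * ((d2 e).card - 1)) := by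
    intro e he
    obtain ⟨heE, h1, h2⟩ := Finset.mem_filter.1 he
    have k1 : 1 ≤ (d1 e).card := Finset.card_pos.2 ⟨e, by simp [d1, heE]⟩
    have k2 : 1 ≤ (d2 e).card := Finset.card_pos.2 ⟨e, by simp [d2, heE]⟩
    obtain ⟨x, hx⟩ := Nat.exists_eq_add_of_le k1
    obtain ⟨y, hy⟩ := Nat.exists_eq_add_of_le k2
    rw [hx] at h1
    rw [hy] at h2
    rw [hx, hy]
    have m1 : N ≤ 8 * a * x := by nlinarith
    have m2 : N ≤ 8 * b * y := by nlinarith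
    calc N * N ≤ (8 * a * x) * (8 * b * y) := Nat.mul_le_mul m1 m2
      _ = _ := by simp; ring
  have hsum : G.card * (N * N) ≤ 64 * (a * b) * (a * b) := by
    calc G.card * (N * N) = ∑ e ∈ G, N * N := by simp
      _ ≤ ∑ e ∈ G, 64 * (a * b) * (((d1 e).card - 1) * ((d2 e).card - 1)) := Finset.sum_le_sum hlow
      _ ≤ ∑ e ∈ E, 64 * (a * b) * (((d1 e).card - 1) * ((d2 e).card - 1)) :=
          Finset.sum_le_sum_of_subset (Finset.filter_subset _ _)
      _ = 64 * (a * b) * ∑ e ∈ E, ((d1 e).card - 1) * ((d2 e).card - 1) := by rw [Finset.mul_sum]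
      _ ≤ _ := Nat.mul_le_mul_left _ hpaths
  calc N ^ 3 = N * (N * N) := by ring
    _ ≤ 2 * G.card * (N * N) := Nat.mul_le_mul_right _ hG
    _ = 2 * (G.card * (N * N)) := by ring
    _ ≤ 2 * (64 * (a * b) * (a * b)) := Nat.mul_le_mul_left _ hsum
    _ = _ := by ring

theorem split_num (n y m : ℕ) (hn : n ≤ y ^ 3) (hm : 0 < m) (hmn : m ≤ n) :
    ∃ u v, m = u * v ∧ ((v.Prime ∧ y ^ 2 < v) ∨ (u ≤ y ^ 2 ∧ v ≤ y ^ 2)) := by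
  classical
  by_cases h : ∃ p, p.Prime ∧ p ∣ m ∧ y ^ 2 < p
  · obtain ⟨p, hp, ⟨u, hu⟩, hy⟩ := h
    exact ⟨u, p, by rw [hu, mul_comm], Or.inl ⟨hp, hy⟩⟩
  push Not at h
  have hy : 0 < y := by
    rcases Nat.eq_zero_or_pos y with rfl | h
    · simp at hn; omega
    · exact h
  have hne : (m.divisors.filter (· ≤ y ^ 2)).Nonempty :=
    ⟨1, by simp [hm.ne']; exact Nat.one_le_pow _ _ hy⟩
  obtain ⟨v, hv, hmax⟩ := Finset.exists_max_image _ id hne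
  simp only [Finset.mem_filter, Nat.mem_divisors, id] at hv hmax
  obtain ⟨⟨⟨u, hu⟩, -⟩, hvy⟩ := hv
  refine ⟨u, v, by rw [hu, mul_comm], Or.inr ⟨?_, hvy⟩⟩
  by_contra hcon
  push Not at hcon
  have hvlt : v < y := by
    by_contra hh
    push Not at hh
    have : y * (y ^ 2 + 1) ≤ v * u := Nat.mul_le_mul hh hcon
    nlinarith
  obtain ⟨p, hp, hpu⟩ := Nat.exists_prime_and_dvd (n := u) (by
    intro h; rw [h] at hcon; nlinarith)
  have hpm : p ∣ m := hu ▸ hpu.mul_left v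
  have hpy := h p hp hpm
  have h1 := hmax p ⟨⟨hpm, hm.ne'⟩, hpy⟩
  have hv0 : 0 < v := by
    rcases Nat.eq_zero_or_pos v with rfl | h
    · simp at hu; omega
    · exact h
  by_cases h2 : v * p ≤ y ^ 2
  · have h3 := hmax (v * p) ⟨⟨hu ▸ Nat.mul_dvd_mul_left v hpu, hm.ne'⟩, h2⟩
    have := hp.two_le
    nlinarith
  · nlinarith

theorem type1_bound (E : Finset (ℕ × ℕ)) (n y : ℕ) (h4 : C4free E)
    (hE : ∀ e ∈ E, e.2.Prime ∧ e.2 ≤ n ∧ e.1 < y) :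
    E.card ≤ Nat.primeCounting n + y ^ 2 := by
  classical
  have hex : ∀ v, ∃ u0, (∃ u, (u, v) ∈ E) → (u0, v) ∈ E := by
    intro v
    by_cases h : ∃ u, (u, v) ∈ E
    · obtain ⟨u, hu⟩ := h; exact ⟨u, fun _ => hu⟩
    · exact ⟨0, fun h' => absurd h' h⟩
  choose u0 hu0 using hex
  rw [← Finset.card_filter_add_card_filter_not (s := E) (fun e => e.1 = u0 e.2)]
  apply add_le_add
  · rw [← Nat.primesLE_card_eq_primeCounting]
    apply Finset.card_le_card_of_injOn Prod.snd
    · intro e he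
      simp at he
      simp [Nat.mem_primesLE]
      exact ⟨(hE _ he.1).2.1, (hE _ he.1).1⟩
    · rintro ⟨u, v⟩ h ⟨u', v'⟩ h' heq
      simp at h h' heq
      subst heq
      rw [h.2, h'.2]
  · have : y ^ 2 = (Finset.range y ×ˢ Finset.range y).card := by simp [sq]
    rw [this]
    apply Finset.card_le_card_of_injOn (fun e => (u0 e.2, e.1))
    · rintro ⟨u, v⟩ he
      simp at he
      simp
      exact ⟨(hE _ (hu0 v ⟨u, he.1⟩)).2.2, (hE _ he.1).2.2⟩
    · rintro ⟨u, v⟩ h ⟨u', v'⟩ h' heq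
      simp at h h' heq
      obtain ⟨h1, rfl⟩ := heq
      by_contra hne
      have hv : v ≠ v' := fun h => hne (by rw [h])
      exact h4 u (u0 v) v v' h.2 hv h.1 h'.1 (hu0 v ⟨u, h.1⟩) (h1 ▸ hu0 v' ⟨u, h'.1⟩)

theorem type2_bound (E : Finset (ℕ × ℕ)) (n y : ℕ) (hy : 0 < y) (hn : n ≤ y ^ 3) (h4 : C4free E)
    (h6 : C6free E) (hE : ∀ e ∈ E, 0 < e.1 ∧ 0 < e.2 ∧ e.1 * e.2 ≤ n ∧ e.1 ≤ y ^ 2 ∧ e.2 ≤ y ^ 2) :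
    E.card ≤ (Nat.log 2 (y ^ 2) + 1) * (8 * y ^ 2) := by
  classical
  rw [Finset.card_eq_sum_card_fiberwise (f := fun e => Nat.log 2 e.2)
    (t := Finset.range (Nat.log 2 (y ^ 2) + 1))]
  · rw [← smul_eq_mul, ← Finset.card_range (Nat.log 2 (y ^ 2) + 1)]
    rw [Finset.card_range (Nat.log 2 (y ^ 2) + 1)]
    conv_rhs => rw [← Finset.card_range (Nat.log 2 (y ^ 2) + 1)]
    apply Finset.sum_le_card_nsmul
    intro i hi
    simp only [Finset.mem_range] at hi
    set Ei := E.filter fun e => Nat.log 2 e.2 = i with hEi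
    have hsub : Ei ⊆ E := Finset.filter_subset _ _
    have h2i : 2 ^ i ≤ y ^ 2 := Nat.pow_le_of_le_log (by positivity) (by omega)
    let A := Finset.Icc 1 (min (n / 2 ^ i) (y ^ 2))
    let B := Finset.Ico (2 ^ i) (2 ^ (i + 1))
    have hA : A.card = min (n / 2 ^ i) (y ^ 2) := by simp [A]
    have hB : B.card = 2 ^ i := by simp [B, pow_succ]; omega
    have hAB : A.card * B.card ≤ y ^ 3 := by
      rw [hA, hB]
      exact (Nat.mul_le_mul_right _ (min_le_left _ _)).trans ((Nat.div_mul_le_self _ _).trans hn)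
    by_contra hcon
    push Not at hcon
    have hA2 : A.card ≤ y ^ 2 := hA ▸ min_le_right _ _
    have := girth8_bound Ei A B (by
      intro e he
      obtain ⟨he, hl⟩ := Finset.mem_filter.1 he
      obtain ⟨k1, k2, k3, k4, k5⟩ := hE e he
      have l1 : 2 ^ i ≤ e.2 := hl ▸ Nat.pow_log_le_self 2 k2.ne'
      have l2 : e.2 < 2 ^ (i + 1) := hl ▸ Nat.lt_pow_succ_log_self (by norm_num) _
      refine ⟨?_, by simp [B, l1, l2]⟩
      simp only [A, Finset.mem_Icc, le_min_iff]
      refine ⟨k1, ?_, k4⟩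
      rw [Nat.le_div_iff_mul_le (by positivity)]
      exact (Nat.mul_le_mul_left _ l1).trans k3)
      (fun u1 u2 v1 v2 a b c d e f => h4 u1 u2 v1 v2 a b (hsub c) (hsub d) (hsub e) (hsub f))
      (fun u1 u2 u3 v1 v2 v3 a b c d e f g h i j k l => h6 u1 u2 u3 v1 v2 v3 a b c d e f
        (hsub g) (hsub h) (hsub i) (hsub j) (hsub k) (hsub l)) (by omega) (by omega)
    have h1 : (8 * y ^ 2) ^ 3 < Ei.card ^ 3 := Nat.pow_lt_pow_left hcon (by norm_num)
    have h2 : (A.card * B.card) ^ 2 ≤ (y ^ 3) ^ 2 := Nat.pow_le_pow_left hAB 2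
    have h3 : 0 < y ^ 6 := by positivity
    have e1 : (8 * y ^ 2) ^ 3 = 512 * y ^ 6 := by ring
    have e2 : (y ^ 3) ^ 2 = y ^ 6 := by ring
    omega
  · intro e he
    have := hE e he
    simp
    have := Nat.log_mono_right (b := 2) this.2.2.2.2
    omega

theorem upper_nat (j n y : ℕ) (hy : 0 < y) (hn : n ≤ y ^ 3) :
    fkd (3 * j + 9) 3 n ≤ Nat.primeCounting n + y ^ 2 + (Nat.log 2 (y ^ 2) + 1) * (8 * y ^ 2) := by
  classical
  apply csSup_le
  · refine ⟨0, ∅, by simp, by simp, ?_⟩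
    intro a x ha
    exact absurd (ha ⟨0, by omega⟩) (by simp)
  rintro m ⟨A, hA, rfl, hv⟩
  have hA' : ∀ m ∈ A, 0 < m ∧ m ≤ n := fun m hm => by
    have := Finset.mem_Icc.1 (hA hm); omega
  have hsp : ∀ m, ∃ u v, m ∈ A → m = u * v ∧ ((v.Prime ∧ y ^ 2 < v) ∨ (u ≤ y ^ 2 ∧ v ≤ y ^ 2)) := by
    intro m
    by_cases hm : m ∈ A
    · obtain ⟨u, v, h⟩ := split_num n y m hn (hA' m hm).1 (hA' m hm).2
      exact ⟨u, v, fun _ => h⟩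
    · exact ⟨0, 0, fun h => absurd h hm⟩
  choose U V hUV using hsp
  let E : Finset (ℕ × ℕ) := A.image fun m => (U m, V m)
  have hmem : ∀ e ∈ E, e.1 * e.2 ∈ A ∧ e = (U (e.1 * e.2), V (e.1 * e.2)) := by
    intro e he
    obtain ⟨m, hm, rfl⟩ := Finset.mem_image.1 he
    simp only
    rw [← (hUV m hm).1]
    exact ⟨hm, rfl⟩
  have hcard : E.card = A.card := by
    apply Finset.card_image_of_injOn
    intro m hm m' hm' h
    simp at h
    rw [(hUV m hm).1, (hUV m' hm').1, h.1, h.2]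
  have hE1 : ∀ e ∈ E, e.1 * e.2 ∈ A := fun e he => (hmem e he).1
  have hE2 : ∀ e ∈ E, 0 < e.1 ∧ 0 < e.2 := fun e he => by
    have := (hA' _ (hE1 e he)).1
    exact ⟨Nat.pos_of_mul_pos_right this, Nat.pos_of_mul_pos_left this⟩
  have hE3 : ∀ e ∈ E, ∀ e' ∈ E, e.1 * e.2 = e'.1 * e'.2 → e = e' := by
    intro e he e' he' h
    rw [(hmem e he).2, (hmem e' he').2, h]
  have hE4 : ∀ e ∈ E, (e.2.Prime ∧ y ^ 2 < e.2) ∨ (e.1 ≤ y ^ 2 ∧ e.2 ≤ y ^ 2) := by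
    intro e he
    obtain ⟨m, hm, rfl⟩ := Finset.mem_image.1 he
    exact (hUV m hm).2
  have h4 := c4free_of_valid hv E hE1 hE2 hE3
  have h6 := c6free_of_valid hv E hE1 hE2 hE3
  rw [← hcard, ← Finset.card_filter_add_card_filter_not (s := E) (fun e => y ^ 2 < e.2)]
  apply add_le_add
  · apply type1_bound
    · intro u1 u2 v1 v2 a b c d e f
      exact h4 u1 u2 v1 v2 a b (Finset.mem_filter.1 c).1 (Finset.mem_filter.1 d).1
        (Finset.mem_filter.1 e).1 (Finset.mem_filter.1 f).1
    · intro e he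
      obtain ⟨he, hlt⟩ := Finset.mem_filter.1 he
      have hle := (hA' _ (hE1 e he)).2
      have hp := hE2 e he
      refine ⟨?_, ?_, ?_⟩
      · rcases hE4 e he with h | h
        · exact h.1
        · omega
      · nlinarith
      · by_contra hh
        push Not at hh
        have : y * (y ^ 2 + 1) ≤ e.1 * e.2 := Nat.mul_le_mul hh hlt
        nlinarith
  · apply type2_bound _ n y hy hn
    · intro u1 u2 v1 v2 a b c d e f
      exact h4 u1 u2 v1 v2 a b (Finset.mem_filter.1 c).1 (Finset.mem_filter.1 d).1
        (Finset.mem_filter.1 e).1 (Finset.mem_filter.1 f).1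
    · intro u1 u2 u3 v1 v2 v3 a b c d e f g h i j k l
      exact h6 u1 u2 u3 v1 v2 v3 a b c d e f (Finset.mem_filter.1 g).1 (Finset.mem_filter.1 h).1
        (Finset.mem_filter.1 i).1 (Finset.mem_filter.1 j).1 (Finset.mem_filter.1 k).1
        (Finset.mem_filter.1 l).1
    · intro e he
      obtain ⟨he, hlt⟩ := Finset.mem_filter.1 he
      refine ⟨(hE2 e he).1, (hE2 e he).2, (hA' _ (hE1 e he)).2, ?_⟩
      rcases hE4 e he with h | h
      · omega
      · exact h

theorem upper_asymp (j : ℕ) : ∀ᶠ n : ℕ in atTop,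
    (fkd (3 * j + 9) 3 n : ℝ) ≤ (Nat.primeCounting n : ℝ) + 132 * (n : ℝ) ^ ((2 : ℝ)/3) * Real.log n := by
  filter_upwards [eventually_ge_atTop 3] with n hn
  have hn' : (3 : ℝ) ≤ n := by exact_mod_cast hn
  set r : ℝ := (n : ℝ) ^ ((1:ℝ)/3) with hr
  have hr1 : 1 ≤ r := Real.one_le_rpow (by linarith) (by norm_num)
  have hr3 : r ^ 3 = n := by
    rw [hr, ← Real.rpow_natCast, ← Real.rpow_mul (by positivity)]; norm_num
  have hr2 : (n : ℝ) ^ ((2:ℝ)/3) = r ^ 2 := by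
    rw [hr, ← Real.rpow_natCast, ← Real.rpow_mul (by positivity)]; norm_num
  set y := ⌈r⌉₊ with hy
  have hyr : r ≤ y := Nat.le_ceil r
  have hyr2 : (y : ℝ) ≤ 2 * r := by
    have := Nat.ceil_lt_add_one (by linarith : 0 ≤ r)
    linarith
  have hy0 : 0 < y := Nat.ceil_pos.2 (by linarith)
  have hny : n ≤ y ^ 3 := by
    have : (n : ℝ) ≤ (y : ℝ) ^ 3 := by rw [← hr3]; gcongr
    exact_mod_cast this
  have hyn : y ≤ n := by
    apply Nat.ceil_le.2
    rw [← hr3]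
    nlinarith [sq_nonneg r]
  have h := upper_nat j n y hy0 hny
  have hR : (fkd (3 * j + 9) 3 n : ℝ) ≤ Nat.primeCounting n + (y:ℝ) ^ 2 +
      ((Nat.log 2 (y ^ 2) : ℝ) + 1) * (8 * (y:ℝ) ^ 2) := by exact_mod_cast h
  have hlogn : 1 ≤ Real.log n := by
    rw [Real.le_log_iff_exp_le (by linarith)]
    have := Real.exp_one_lt_d9
    linarith
  have hlog : (Nat.log 2 (y ^ 2) : ℝ) ≤ 3 * Real.log n := by
    have h1 : 2 ^ Nat.log 2 (y ^ 2) ≤ y ^ 2 := Nat.pow_log_le_self 2 (by positivity)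
    have h2 : 2 ^ Nat.log 2 (y ^ 2) ≤ n ^ 2 := h1.trans (Nat.pow_le_pow_left hyn 2)
    have h3 : ((2:ℝ)) ^ Nat.log 2 (y ^ 2) ≤ (n:ℝ) ^ 2 := by exact_mod_cast h2
    have h4 := Real.log_le_log (by positivity) h3
    rw [Real.log_pow, Real.log_pow] at h4
    have := Real.log_two_gt_d9
    push_cast at h4
    have h5 : (0:ℝ) ≤ (Nat.log 2 (y ^ 2) : ℝ) := by positivity
    nlinarith
  have hy2 : (y : ℝ) ^ 2 ≤ 4 * r ^ 2 := by
    calc (y : ℝ) ^ 2 ≤ (2 * r) ^ 2 := by gcongr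
      _ = _ := by ring
  rw [hr2]
  have hfac : (1 : ℝ) + ((Nat.log 2 (y ^ 2) : ℝ) + 1) * 8 ≤ 33 * Real.log n := by linarith
  have : (y:ℝ) ^ 2 * (1 + ((Nat.log 2 (y ^ 2) : ℝ) + 1) * 8) ≤ (4 * r ^ 2) * (33 * Real.log n) := by
    gcongr
  linarith

theorem stmt_14 (ℓ : ℕ) (hℓ : 2 ≤ ℓ) :
    ∃ c1 c2 c3 c4 : ℝ, 0 < c1 ∧ 0 < c2 ∧ 0 < c3 ∧ 0 < c4 ∧ ∀ᶠ n : ℕ in Filter.atTop,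
      ((Nat.primeCounting n : ℝ)
          + c1 * (n : ℝ) ^ ((3 * (ℓ : ℝ)) / (6 * (ℓ : ℝ) - 2))
              / (Real.log n) ^ ((3 * (ℓ : ℝ)) / (3 * (ℓ : ℝ) - 1))
        ≤ (fkd (6 * ℓ) 3 n : ℝ) ∧
      (fkd (6 * ℓ) 3 n : ℝ)
        ≤ (Nat.primeCounting n : ℝ) + c2 * (n : ℝ) ^ ((2 : ℝ)/3) * Real.log n) ∧
      ((Nat.primeCounting n : ℝ)
          + c3 * (n : ℝ) ^ ((3 * (ℓ : ℝ) + 1) / (6 * (ℓ : ℝ)))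
              / (Real.log n) ^ ((3 * (ℓ : ℝ) + 1) / (3 * (ℓ : ℝ)))
        ≤ (fkd (6 * ℓ + 3) 3 n : ℝ) ∧
      (fkd (6 * ℓ + 3) 3 n : ℝ)
        ≤ (Nat.primeCounting n : ℝ) + c4 * (n : ℝ) ^ ((2 : ℝ)/3) * Real.log n) := by
  obtain ⟨c1, hc1, h1⟩ := lower_asymp (3 * ℓ - 1) (by omega) (fkd (6 * ℓ) 3) (by
    intro q n hq h
    have := lower_count q hq ℓ ℓ n (by omega) le_rfl (by omega)
    rw [show 2 * ℓ + ℓ - 1 = 3 * ℓ - 1 by omega, show 3 * (ℓ + ℓ) = 6 * ℓ by omega] at this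
    exact this h)
  obtain ⟨c3, hc3, h3⟩ := lower_asymp (3 * ℓ) (by omega) (fkd (6 * ℓ + 3) 3) (by
    intro q n hq h
    have := lower_count q hq ℓ (ℓ + 1) n (by omega) (by omega) le_rfl
    rw [show 2 * ℓ + (ℓ + 1) - 1 = 3 * ℓ by omega,
      show 3 * (ℓ + (ℓ + 1)) = 6 * ℓ + 3 by omega] at this
    exact this h)
  have u1 := upper_asymp (2 * ℓ - 3)
  have u2 := upper_asymp (2 * ℓ - 2)
  rw [show 3 * (2 * ℓ - 3) + 9 = 6 * ℓ by omega] at u1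
  rw [show 3 * (2 * ℓ - 2) + 9 = 6 * ℓ + 3 by omega] at u2
  have hc : ((3 * ℓ - 1 : ℕ) : ℝ) = 3 * (ℓ : ℝ) - 1 := by
    rw [Nat.cast_sub (by omega)]; push_cast; ring
  rw [hc, show (3 * (ℓ : ℝ) - 1 + 1) = 3 * (ℓ : ℝ) by ring,
    show 2 * (3 * (ℓ : ℝ) - 1) = 6 * (ℓ : ℝ) - 2 by ring] at h1
  have hc' : ((3 * ℓ : ℕ) : ℝ) = 3 * (ℓ : ℝ) := by push_cast; ring
  rw [hc', show 2 * (3 * (ℓ : ℝ)) = 6 * (ℓ : ℝ) by ring] at h3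
  refine ⟨c1, 132, c3, 132, hc1, by norm_num, hc3, by norm_num, ?_⟩
  filter_upwards [h1, h3, u1, u2] with n a b c d
  exact ⟨⟨a, c⟩, b, d⟩
end
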